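/- arXiv:math/0301194 — 2 statements merged into one kernel-verified Lean document; each statement's English description precedes it below -/
import Mathlib

section
/- Let n ≥ 1 and for (t,u) ∈ ℂ × ℂ^n and x ∈ ℂ^n set F_n(t,u,x) := Σ_{i=1}^n 2^{i−1}x_i + t·∏_{i=1}^n (1 + (u_i − 1)x_i). Let m be a natural number and suppose there are polynomial maps θ : ℂ × ℂ^n → ℂ^m and ω* : ℂ^m → ℂ^{2^n} such that for every (t,u) ∈ ℂ × ℂ^n the identity Y^{2^n} + Σ_{k=1}^{2^n} (ω*(θ(t,u)))_k · Y^{2^n−k} = ∏_{ε ∈ {0,1}^n} (Y − F_n(t,u,ε)) holds in ℂ[Y]. Suppose moreover that the set {θ(0,u) : u ∈ ℂ^n} is finite (a condition that holds whenever θ is a robust elimination procedure, since F_n(0,u,·) is independent of u). Then m ≥ 2^n. -/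
open scoped BigOperators

/-- A polynomial map `ℂ^a → ℂ^b`: each coordinate is given by evaluating a
polynomial in `a` variables with complex coefficients. -/
def IsPolyMap {a b : ℕ} (f : (Fin a → ℂ) → (Fin b → ℂ)) : Prop :=
  ∃ p : Fin b → MvPolynomial (Fin a) ℂ,
    ∀ (x : Fin a → ℂ) (i : Fin b), f x i = MvPolynomial.eval x (p i)

/-- A polynomial map `ℂ × ℂ^n → ℂ^b`: each coordinate is given by evaluating a
polynomial in `n+1` variables with complex coefficients. -/
def IsPolyMapProd (n b : ℕ) (f : ℂ × (Fin n → ℂ) → (Fin b → ℂ)) : Prop :=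
  ∃ p : Fin b → MvPolynomial (Fin (n + 1)) ℂ,
    ∀ (t : ℂ) (u : Fin n → ℂ) (i : Fin b),
      f (t, u) i = MvPolynomial.eval (Fin.cons t u) (p i)

/-- `F_n(t,u,x) = Σ_{i=1}^n 2^{i−1}x_i + t·∏_{i=1}^n (1+(u_i−1)x_i)`. -/
noncomputable def Fnval (n : ℕ) (t : ℂ) (u x : Fin n → ℂ) : ℂ :=
  ∑ i : Fin n, 2 ^ (i : ℕ) * x i + t * ∏ i : Fin n, (1 + (u i - 1) * x i)

lemma aux_const {n m : ℕ} (f : (Fin n → ℂ) → (Fin m → ℂ)) (hc : Continuous f)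
    (hfin : (Set.range f).Finite) (u : Fin n → ℂ) : f u = f 0 := by
  have : Finite (Set.range f) := hfin
  exact isPreconnected_univ.constant_of_mapsTo (T := Set.range f) hfin.isDiscrete hc.continuousOn
    (fun x _ => ⟨x, rfl⟩) (Set.mem_univ _) (Set.mem_univ _)

lemma aux_diff {a : ℕ} (p : MvPolynomial (Fin a) ℂ) :
    Differentiable ℂ (fun x : Fin a → ℂ => MvPolynomial.eval x p) := by
  induction p using MvPolynomial.induction_on with
  | C c => simp
  | add p q hp hq => simp only [map_add]; exact hp.fun_add hq
  | mul_X p i hp => simp only [map_mul, MvPolynomial.eval_X]; exact hp.fun_mul (differentiable_apply i)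

noncomputable def auxN {n : ℕ} (ε : Fin n → Bool) : ℂ :=
  ∑ i : Fin n, 2 ^ (i : ℕ) * (if ε i then 1 else 0)

noncomputable def auxM {n : ℕ} (u : Fin n → ℂ) (ε : Fin n → Bool) : ℂ :=
  ∏ i : Fin n, (1 + (u i - 1) * (if ε i then 1 else 0))

lemma auxN_inj {n : ℕ} : Function.Injective (auxN (n := n)) := by
  intro a b h
  have key : ∀ e : Fin n → Bool, auxN e =
      ((∑ i ∈ (Finset.univ.filter (fun i => e i = true)).map Fin.valEmbedding, 2 ^ i : ℕ) : ℂ) := by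
    intro e
    simp [auxN, Finset.sum_filter]
  rw [key, key, Nat.cast_inj] at h
  have h2 := Finset.map_injective _ (Finset.geomSum_injective (le_refl 2) h)
  funext i
  have := Finset.ext_iff.1 h2 i
  simp at this
  exact this

lemma auxM_indep {n : ℕ} (a : (Fin n → Bool) → ℂ)
    (h : ∀ u : Fin n → ℂ, ∑ ε, a ε * auxM u ε = 0) : ∀ ε, a ε = 0 := by
  intro ε
  induction ε using WellFoundedLT.induction with
  | ind ε ih =>
    have := h (fun i => if ε i then 1 else 0)
    rw [Finset.sum_eq_single ε] at this
    · have h1 : auxM (fun i => if ε i then (1:ℂ) else 0) ε = 1 := by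
        unfold auxM
        apply Finset.prod_eq_one
        intro i _
        by_cases hi : ε i <;> simp [hi]
      simpa [h1] using this
    · intro b _ hb
      by_cases hle : b ≤ ε
      · rw [ih b (lt_of_le_of_ne hle hb), zero_mul]
      · rw [Pi.le_def] at hle
        push Not at hle
        obtain ⟨i, hi⟩ := hle
        have : auxM (fun i => if ε i then (1:ℂ) else 0) b = 0 := by
          unfold auxM
          apply Finset.prod_eq_zero (Finset.mem_univ i)
          have : ε i = false ∧ b i = true := by
            revert hi; cases ε i <;> cases b i <;> simp
          simp [this.1, this.2]
        rw [this, mul_zero]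
    · simp

lemma auxDeriv {n : ℕ} (u : Fin n → ℂ) (e : Fin n → Bool) :
    HasDerivAt (fun t : ℂ => ∏ ε : Fin n → Bool, (auxN e - (auxN ε + t * auxM u ε)))
      (-(∏ ε ∈ Finset.univ.erase e, (auxN e - auxN ε)) * auxM u e) 0 := by
  have h1 : (fun t : ℂ => ∏ ε : Fin n → Bool, (auxN e - (auxN ε + t * auxM u ε))) =
      fun t => t * ((-auxM u e) * ∏ ε ∈ Finset.univ.erase e, (auxN e - (auxN ε + t * auxM u ε))) := by
    funext t
    rw [← Finset.mul_prod_erase _ _ (Finset.mem_univ e)]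
    ring
  rw [h1]
  have hd : DifferentiableAt ℂ (fun t : ℂ => (-auxM u e) *
      ∏ ε ∈ Finset.univ.erase e, (auxN e - (auxN ε + t * auxM u ε))) 0 := by
    fun_prop
  refine ((hasDerivAt_id' (0:ℂ)).fun_mul hd.hasDerivAt).congr_deriv ?_
  simp only [zero_mul, add_zero, one_mul]
  ring

/-- Any robust elimination procedure `(θ, ω*)` computing the elimination
polynomial `∏_{ε ∈ {0,1}^n}(Y − F_n(t,u,ε))` of the flat family
`X_i² − X_i = 0`, `F_n`, requires an output data structure of size
`m ≥ 2^n`. -/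
theorem elimination_lower_bound (n m : ℕ) (hn : 1 ≤ n)
    (θ : ℂ × (Fin n → ℂ) → (Fin m → ℂ)) (ωs : (Fin m → ℂ) → (Fin (2 ^ n) → ℂ))
    (hθ : IsPolyMapProd n m θ) (hω : IsPolyMap ωs)
    (hcomp : ∀ (t : ℂ) (u : Fin n → ℂ),
      (Polynomial.X : Polynomial ℂ) ^ 2 ^ n +
          ∑ k : Fin (2 ^ n),
            Polynomial.C (ωs (θ (t, u)) k) * Polynomial.X ^ (2 ^ n - 1 - (k : ℕ)) =
        ∏ ε : Fin n → Bool,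
          (Polynomial.X -
            Polynomial.C (Fnval n t u fun i => if ε i then 1 else 0)))
    (hfin : (Set.range fun u : Fin n → ℂ => θ (0, u)).Finite) :
    2 ^ n ≤ m := by
  obtain ⟨p, hp⟩ := hθ
  obtain ⟨q, hq⟩ := hω
  have hθd : ∀ (u : Fin n → ℂ), Differentiable ℂ (fun t : ℂ => θ (t, u)) := by
    intro u
    rw [differentiable_pi]
    intro i
    simp only [hp]
    refine (aux_diff (p i)).comp (differentiable_pi.2 fun j => ?_)
    refine Fin.cases ?_ (fun j => ?_) j <;> simp
  have hθc : Continuous (fun u : Fin n → ℂ => θ (0, u)) := by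
    refine continuous_pi fun i => ?_
    simp only [hp]
    refine (aux_diff (p i)).continuous.comp (continuous_pi fun j => ?_)
    refine Fin.cases ?_ (fun j => ?_) j
    · simpa using continuous_const
    · simpa using continuous_apply j
  have hconst := aux_const _ hθc hfin
  have hωd : ∀ k, Differentiable ℂ (fun x => ωs x k) := by
    intro k
    simp only [hq]
    exact aux_diff _
  let G : (Fin n → Bool) → (Fin m → ℂ) → ℂ := fun e x =>
    auxN e ^ 2 ^ n + ∑ k : Fin (2 ^ n), ωs x k * auxN e ^ (2 ^ n - 1 - (k : ℕ))
  have hG : ∀ e, Differentiable ℂ (G e) := by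
    intro e
    have := hωd
    fun_prop
  let L : (Fin n → Bool) → Module.Dual ℂ (Fin m → ℂ) := fun e =>
    (fderiv ℂ (G e) (θ (0, 0))).toLinearMap
  let c : (Fin n → Bool) → ℂ := fun e => -(∏ ε ∈ Finset.univ.erase e, (auxN e - auxN ε))
  have hc : ∀ e, c e ≠ 0 := by
    intro e
    refine neg_ne_zero.2 (Finset.prod_ne_zero_iff.2 fun ε hε => sub_ne_zero.2 fun h => ?_)
    exact (Finset.mem_erase.1 hε).1 (auxN_inj h).symm
  have hL : ∀ e u, L e (deriv (fun t : ℂ => θ (t, u)) 0) = c e * auxM u e := by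
    intro e u
    have h1 : (fun t : ℂ => G e (θ (t, u))) =
        fun t : ℂ => ∏ ε : Fin n → Bool, (auxN e - (auxN ε + t * auxM u ε)) := by
      funext t
      have := congrArg (Polynomial.eval (auxN e)) (hcomp t u)
      simpa [Polynomial.eval_finsetSum, Polynomial.eval_prod, Fnval, G, auxN, auxM] using this
    have h2 := (h1 ▸ auxDeriv u e :
      HasDerivAt (fun t : ℂ => G e (θ (t, u))) (c e * auxM u e) 0)
    have h3 : HasFDerivAt (G e) (fderiv ℂ (G e) (θ (0, 0))) (θ (0, u)) := by
      have := hconst u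
      rw [this]
      exact (hG e _).hasFDerivAt
    have h4 := HasFDerivAt.comp_hasDerivAt (f := fun t : ℂ => θ (t, u)) (0:ℂ) h3 (hθd u 0).hasDerivAt
    exact h4.unique h2
  have hli : LinearIndependent ℂ L := by
    rw [Fintype.linearIndependent_iff]
    intro a ha e
    have := auxM_indep (fun ε => a ε * c ε) (fun u => by
      have := congrArg (fun l : Module.Dual ℂ (Fin m → ℂ) => l (deriv (fun t : ℂ => θ (t, u)) 0)) ha
      simp only [LinearMap.sum_apply, LinearMap.smul_apply, hL, smul_eq_mul,
        LinearMap.zero_apply] at this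
      simpa [mul_assoc] using this) e
    exact (mul_eq_zero.1 this).resolve_right (hc e)
  have := hli.fintype_card_le_finrank
  simpa [Subspace.dual_finrank_eq] using this
end

section
/- Let t, L, K ≥ 1, Δ ≥ 1, Δ1 ≥ 0, Δ2 ≥ 1 and m ≥ 2L+2 be integers. Let G_1,…,G_K ∈ ℚ[Z_1,…,Z_L] have total degree at most Δ1, and let D ⊆ ℂ^L be any set belonging to the Boolean algebra of subsets of ℂ^L generated by the K zero sets {c ∈ ℂ^L : G_i(c) = 0}. For each exponent vector α ∈ ℕ^t with |α| ≤ Δ let Ω_α ∈ ℚ[Z_1,…,Z_L] have total degree at most Δ2, for c ∈ ℂ^L set Q_c := Σ_{|α|≤Δ} Ω_α(c)·Y^α ∈ ℂ[Y_1,…,Y_t], let O := {Q_c : c ∈ D}, and let Ō be the Zariski closure of O in the coefficient space of polynomials of total degree at most Δ in Y_1,…,Y_t. Let M ⊆ ℚ be a finite set with #M ≥ 2 and #M ≥ Δ²·(L+1)^{1/L}·(1+K·Δ1)·Δ2 (an inequality of real numbers). Then there exist points γ_1,…,γ_m ∈ M^t forming a correct test sequence for Ō, i.e., every F ∈ Ō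 with F(γ_1) = ⋯ = F(γ_m) = 0 is the zero polynomial; moreover the number of m-tuples (γ_1,…,γ_m) ∈ (M^t)^m that fail to be correct test sequences for Ō is at most (#M)^{mt−1}. -/
open scoped BigOperators

/-- A subset of `ℂ^ι` is Zariski closed if it is the common zero set of a family
of polynomials with complex coefficients. -/
def ZariskiClosed {ι : Type} (S : Set (ι → ℂ)) : Prop :=
  ∃ F : Set (MvPolynomial ι ℂ), S = {x : ι → ℂ | ∀ f ∈ F, MvPolynomial.eval x f = 0}

/-- The Zariski closure of a set: the intersection of all Zariski closed sets
containing it. -/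
def zClosure {ι : Type} (S : Set (ι → ℂ)) : Set (ι → ℂ) :=
  ⋂₀ {C : Set (ι → ℂ) | ZariskiClosed C ∧ S ⊆ C}

/-- Membership in the Boolean algebra of sets generated by a family `G`. -/
inductive InBoolAlg {α : Type*} (G : Set (Set α)) : Set α → Prop
  | basic (s : Set α) : s ∈ G → InBoolAlg G s
  | univ : InBoolAlg G Set.univ
  | compl (s : Set α) : InBoolAlg G s → InBoolAlg G sᶜ
  | inter (s u : Set α) : InBoolAlg G s → InBoolAlg G u → InBoolAlg G (s ∩ u)

/-- Evaluation of a coefficient vector (indexed by exponent vectors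
`α : Fin t → Fin (Δ+1)`) at a point `y ∈ ℂ^t`: the value of the corresponding
polynomial `Σ_α v_α · y^α`. -/
noncomputable def evalVec {t Δ : ℕ} (v : (Fin t → Fin (Δ + 1)) → ℂ) (y : Fin t → ℂ) : ℂ :=
  ∑ α : Fin t → Fin (Δ + 1), v α * ∏ i : Fin t, y i ^ (α i : ℕ)

/-- The object class `O = {Q_c : c ∈ D}`, where `Q_c` is the coefficient vector
`α ↦ Ω_α(c)`. -/
def objClass (t L Δ : ℕ) (D : Set (Fin L → ℂ))
    (Ω : (Fin t → Fin (Δ + 1)) → MvPolynomial (Fin L) ℚ) :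
    Set ((Fin t → Fin (Δ + 1)) → ℂ) :=
  {v | ∃ c ∈ D, v = fun α => MvPolynomial.aeval c (Ω α)}

section
open MvPolynomial

/-- transcendence degree as a natural number -/
noncomputable def tdeg (K B : Type) [Field K] [CommRing B] [Algebra K B] : ℕ :=
  Cardinal.toNat (Algebra.trdeg K B)

noncomputable def pdim {K σ : Type} [Field K] (P : Ideal (MvPolynomial σ K)) : ℕ :=
  tdeg K (MvPolynomial σ K ⧸ P)

theorem tdeg_hypersurface {K : Type} [Field K] {s : ℕ} (g : MvPolynomial (Fin s) K)
    (hg : Prime g) : tdeg K (MvPolynomial (Fin s) K ⧸ Ideal.span {g}) + 1 = s := by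
  classical
  have hI : (Ideal.span {g}).IsPrime := (Ideal.span_singleton_prime hg.ne_zero).2 hg
  set B := MvPolynomial (Fin s) K ⧸ Ideal.span {g}
  have hex : ∃ i, degreeOf i g ≠ 0 := by
    by_contra! h
    have h1 : g.totalDegree = 0 := by
      rw [totalDegree_eq_zero_iff]
      intro m hm i
      have := monomial_le_degreeOf i hm
      rw [h i] at this
      omega
    rw [totalDegree_eq_zero_iff_eq_C] at h1
    have h2 : coeff 0 g ≠ 0 := by
      intro h3; apply hg.ne_zero; rw [h1, h3, C_0]
    apply hg.not_isUnit
    rw [h1]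
    exact (IsUnit.mk0 _ h2).map C
  obtain ⟨i, hi⟩ := hex
  have hlow : AlgebraicIndependent K (fun j : {j : Fin s // j ≠ i} => (Ideal.Quotient.mk (Ideal.span {g}) (X j.1) : B)) := by
    rw [algebraicIndependent_iff]
    intro p hp
    have h1 : (aeval (fun j : {j : Fin s // j ≠ i} => (Ideal.Quotient.mk (Ideal.span {g}) (X j.1) : B))) p
      = Ideal.Quotient.mk (Ideal.span {g}) (rename Subtype.val p) := by
      have : (aeval (fun j : {j : Fin s // j ≠ i} => (Ideal.Quotient.mk (Ideal.span {g}) (X j.1) : B)))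
        = (Ideal.Quotient.mkₐ K (Ideal.span {g})).comp (rename Subtype.val) := by
        apply MvPolynomial.algHom_ext
        intro j
        simp
      rw [this]; rfl
    rw [h1, Ideal.Quotient.eq_zero_iff_mem, Ideal.mem_span_singleton] at hp
    obtain ⟨h, hh⟩ := hp
    by_contra hp0
    have hr : rename (Subtype.val : {j : Fin s // j ≠ i} → Fin s) p ≠ 0 := by
      intro h0
      exact hp0 (rename_injective _ Subtype.val_injective (by rw [h0, map_zero]))
    have hh0 : h ≠ 0 := by
      rintro rfl; apply hr; rw [hh, mul_zero]
    have hd := degreeOf_mul_eq (n := i) hg.ne_zero hh0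
    rw [← hh] at hd
    have : degreeOf i (rename (Subtype.val : {j : Fin s // j ≠ i} → Fin s) p) = 0 := by
      by_contra hv0
      have hv := mem_vars_iff_degreeOf_ne_zero.2 hv0
      obtain ⟨j, _, hj⟩ := mem_vars_rename _ _ hv
      exact j.2 hj
    omega
  have hlow2 := hlow.cardinalMk_le_trdeg
  have hfin : Algebra.trdeg K B < Cardinal.aleph0 := trdeg_lt_aleph0_of_finiteType
  have hcard : Cardinal.mk {j : Fin s // j ≠ i} = ((s - 1 : ℕ) : Cardinal) := by
    rw [Cardinal.mk_fintype]; simp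
  obtain ⟨d, hd⟩ := Cardinal.lt_aleph0.1 hfin
  have htd : tdeg K B = d := by unfold tdeg; rw [hd]; simp
  rw [htd]
  rw [hcard, hd] at hlow2
  have hlow3 : s - 1 ≤ d := by exact_mod_cast hlow2
  have hup : ¬ s ≤ d := by
    intro hle
    have hsurj : Algebra.adjoin K (Set.range (fun j : Fin s => (Ideal.Quotient.mk (Ideal.span {g}) (X j) : B))) = ⊤ := by
      rw [Algebra.adjoin_range_eq_range_aeval, AlgHom.range_eq_top]
      intro b
      obtain ⟨p, rfl⟩ := Ideal.Quotient.mk_surjective b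
      refine ⟨p, ?_⟩
      have : (aeval (fun j : Fin s => (Ideal.Quotient.mk (Ideal.span {g}) (X j) : B)))
        = (Ideal.Quotient.mkₐ K (Ideal.span {g})) := by
        apply MvPolynomial.algHom_ext
        intro j
        simp
      rw [this]; rfl
    have : Algebra.IsAlgebraic (Algebra.adjoin K (Set.range (fun j : Fin s => (Ideal.Quotient.mk (Ideal.span {g}) (X j) : B)))) B := by
      constructor
      intro b
      have hb : b ∈ Algebra.adjoin K (Set.range (fun j : Fin s => (Ideal.Quotient.mk (Ideal.span {g}) (X j) : B))) := by
        rw [hsurj]; trivial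
      exact isAlgebraic_algebraMap (⟨b, hb⟩ : Algebra.adjoin K (Set.range (fun j : Fin s => (Ideal.Quotient.mk (Ideal.span {g}) (X j) : B))))
    have hfs : FaithfulSMul K B := by
      exact (faithfulSMul_iff_algebraMap_injective K B).2 (algebraMap K B).injective
    have hb := Algebra.IsAlgebraic.isTranscendenceBasis_of_le_trdeg_of_finite K (fun j : Fin s => (Ideal.Quotient.mk (Ideal.span {g}) (X j) : B)) (by rw [hd]; simpa using hle)
    have hb2 := hb.1
    rw [algebraicIndependent_iff] at hb2
    apply hg.ne_zero
    apply hb2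
    have : (aeval (fun j : Fin s => (Ideal.Quotient.mk (Ideal.span {g}) (X j) : B)))
        = (Ideal.Quotient.mkₐ K (Ideal.span {g})) := by
        apply MvPolynomial.algHom_ext
        intro j
        simp
    rw [this]
    show Ideal.Quotient.mk _ g = 0
    rw [Ideal.Quotient.eq_zero_iff_mem]
    exact Ideal.mem_span_singleton_self g
  omega

theorem tdeg_of_integral {K R B : Type} [Field K] [CommRing R] [CommRing B] [IsDomain B] [Algebra K R] [Algebra K B]
    [Algebra R B] [IsScalarTower K R B] [Algebra.IsAlgebraic R B] [FaithfulSMul R B] [Nontrivial R]: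
    tdeg K B = tdeg K R := by
  unfold tdeg
  have := trdeg_add_eq K R (A := B)
  rw [trdeg_eq_zero (R := R) (A := B), add_zero] at this
  rw [this]

theorem tdeg_height_one {K B : Type} [Field K] [CommRing B] [IsDomain B] [Algebra K B]
    [Algebra.FiniteType K B] (q : Ideal B) [hqp : q.IsPrime] (hq0 : q ≠ ⊥) (hq : q.height ≤ 1) :
    tdeg K (B ⧸ q) + 1 = tdeg K B := by
  obtain ⟨s, g, ginj, gint⟩ := exists_integral_inj_algHom_of_fg K B
  algebraize [g.toRingHom]
  have hint : Algebra.IsIntegral (MvPolynomial (Fin s) K) B := ⟨gint⟩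
  have hfs : FaithfulSMul (MvPolynomial (Fin s) K) B := by
    rw [faithfulSMul_iff_algebraMap_injective]; exact ginj
  have h1 : tdeg K B = s := by
    rw [tdeg_of_integral (K := K) (R := MvPolynomial (Fin s) K) (B := B)]
    unfold tdeg
    simp
  set p := q.comap (algebraMap (MvPolynomial (Fin s) K) B) with hp
  have hpp : p.IsPrime := Ideal.comap_isPrime _ _
  have hp0 : p ≠ ⊥ := by
    obtain ⟨x, hx, hx0⟩ := Submodule.exists_mem_ne_zero_of_ne_bot hq0
    exact Ideal.comap_ne_bot_of_integral_mem hx0 hx (Algebra.IsIntegral.isIntegral x)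
  obtain ⟨g0, hg0, hg0p⟩ := hpp.exists_mem_prime_of_ne_bot hp0
  have hpeq : p = Ideal.span {g0} := by
    by_contra hne
    have hlt : Ideal.span {g0} < p := lt_of_le_of_ne (by rwa [Ideal.span_singleton_le_iff_mem]) (Ne.symm hne)
    have hsp : (Ideal.span {g0}).IsPrime := (Ideal.span_singleton_prime hg0p.ne_zero).2 hg0p
    have hlo : q.LiesOver p := ⟨rfl⟩
    obtain ⟨P, hPq, hPp, hPo⟩ := Ideal.exists_ideal_lt_liesOver_of_lt (p := Ideal.span {g0}) (q := p) q hlt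
    replace hq : q.height ≤ ((1:ℕ) : ℕ∞) := by simpa using hq
    rw [Ideal.height_le_iff] at hq
    have h3 := hq P hPp hPq
    have h4 : P.height = 0 := by
      exact Order.lt_one_iff.1 h3
    rw [Ideal.height_eq_zero_iff_eq_bot] at h4
    have h5 := hPo.over
    rw [h4] at h5
    have h6 : g0 ∈ Ideal.under (MvPolynomial (Fin s) K) (⊥ : Ideal B) := by
      rw [← h5]; exact Ideal.mem_span_singleton_self g0
    rw [Ideal.under, Ideal.mem_comap, Ideal.mem_bot] at h6
    exact hg0p.ne_zero (ginj (by rw [map_zero]; exact h6))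
  have h2 : tdeg K (B ⧸ q) = tdeg K (MvPolynomial (Fin s) K ⧸ p) := by
    have hlo : q.LiesOver p := ⟨rfl⟩
    have : FaithfulSMul (MvPolynomial (Fin s) K ⧸ p) (B ⧸ q) := by
      rw [faithfulSMul_iff_algebraMap_injective]
      exact Ideal.algebraMap_quotient_injective
    have : Algebra.IsIntegral (MvPolynomial (Fin s) K ⧸ p) (B ⧸ q) := inferInstance
    exact tdeg_of_integral
  rw [h2, hpeq, tdeg_hypersurface g0 hg0p, h1]

theorem pdim_drop {K σ : Type} [Field K] [Finite σ] (P : Ideal (MvPolynomial σ K)) [hP : P.IsPrime]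
    {f : MvPolynomial σ K} (hf : f ∉ P) (Q : Ideal (MvPolynomial σ K))
    (hQ : Q ∈ (P ⊔ Ideal.span {f}).minimalPrimes) : pdim Q + 1 = pdim P := by
  have hQp : Q.IsPrime := hQ.1.1
  have hPQ : P ≤ Q := le_trans le_sup_left hQ.1.2
  have hfQ : f ∈ Q := hQ.1.2 (Ideal.mem_sup_right (Ideal.mem_span_singleton_self f))
  have hh := Ideal.map_height_le_one_of_mem_minimalPrimes hQ
  set q := Q.map (Ideal.Quotient.mkₐ K P) with hq
  have hqp : q.IsPrime := Ideal.map_isPrime_of_surjective (Ideal.Quotient.mk_surjective) (by simpa using hPQ)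
  have h0 : q ≠ ⊥ := by
    intro h
    have : Ideal.Quotient.mkₐ K P f ∈ q := Ideal.mem_map_of_mem _ hfQ
    rw [h, Ideal.mem_bot] at this
    exact hf (Ideal.Quotient.eq_zero_iff_mem.1 this)
  have := tdeg_height_one (K := K) q h0 hh
  unfold pdim
  rw [← this]
  congr 1
  unfold tdeg
  exact congrArg _ (AlgEquiv.trdeg_eq (DoubleQuot.quotQuotEquivQuotOfLEₐ K hPQ)).symm


noncomputable def hfn {K σ : Type} [Field K] (I : Ideal (MvPolynomial σ K)) (n : ℕ) : ℕ :=
  Module.finrank K ((restrictTotalDegree σ K n).map (Ideal.Quotient.mkₐ K I).toLinearMap)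

theorem finrank_rtd {K σ : Type} [Field K] [Fintype σ] (n : ℕ) :
    Module.finrank K (restrictTotalDegree σ K n) = (n + Fintype.card σ).choose (Fintype.card σ) := by
  classical
  have h1 : Module.finrank K (restrictTotalDegree σ K n) = Nat.card {s : σ →₀ ℕ | (s.sum fun _ e => e) ≤ n} :=
    Module.finrank_eq_nat_card_basis (basisRestrictSupport K {s : σ →₀ ℕ | (s.sum fun _ e => e) ≤ n})
  rw [h1]
  have h2 : {s : σ →₀ ℕ | (s.sum fun _ e => e) ≤ n} =
      ((Finset.range (n+1)).biUnion (fun k => (Finset.univ : Finset σ).finsuppAntidiag k) : Finset (σ →₀ ℕ)) := by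
    ext s
    simp [Finsupp.sum_fintype]
  rw [h2]
  rw [Nat.card_coe_set_eq, Set.ncard_coe_finset, Finset.card_biUnion]
  · simp only [Finset.card_finsuppAntidiag_nat_eq_multichoose, Finset.card_univ]
    have h3 : ∀ d m : ℕ, ∑ k ∈ Finset.range (m+1), d.multichoose k = (d+1).multichoose m := by
      intro d m
      induction m with
      | zero => simp
      | succ m ih => rw [Finset.sum_range_succ, ih, Nat.multichoose_succ_succ, add_comm]
    rw [h3, Nat.multichoose_eq]
    have : Fintype.card σ + 1 + n - 1 = n + Fintype.card σ := by omega
    rw [this, Nat.choose_symm_add]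
  · intro a _ b _ hab
    rw [Function.onFun, Finset.disjoint_left]
    intro s hs hs'
    rw [Finset.mem_finsuppAntidiag] at hs hs'
    exact hab (hs.1.symm.trans hs'.1)

theorem hfn_le {K σ : Type} [Field K] [Fintype σ] (I : Ideal (MvPolynomial σ K)) (n : ℕ) :
    hfn I n ≤ (n + Fintype.card σ).choose (Fintype.card σ) := by
  rw [← finrank_rtd (K := K)]
  exact Submodule.finrank_map_le _ _

theorem hfn_mono {K σ : Type} [Field K] [Finite σ] (I : Ideal (MvPolynomial σ K)) {n m : ℕ}
    (h : n ≤ m) : hfn I n ≤ hfn I m := by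
  apply Submodule.finrank_mono
  apply Submodule.map_mono
  intro p hp
  rw [mem_restrictTotalDegree] at *
  omega

theorem exists_indep {K σ : Type} [Field K] [Finite σ] (P : Ideal (MvPolynomial σ K)) [hP : P.IsPrime] :
    ∃ (τ : Type) (_ : Fintype τ) (ρ : τ → σ),
      AlgebraicIndependent K (fun j => (Ideal.Quotient.mkₐ K P (X (ρ j)))) ∧ Fintype.card τ = pdim P := by
  classical
  set B := MvPolynomial σ K ⧸ P
  set x : σ → B := fun j => Ideal.Quotient.mkₐ K P (X j) with hx
  have hae : aeval x = Ideal.Quotient.mkₐ K P := by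
    apply MvPolynomial.algHom_ext
    intro j
    simp only [aeval_X, hx]
  have hsurj : Algebra.adjoin K (Set.range x) = ⊤ := by
    rw [Algebra.adjoin_range_eq_range_aeval, AlgHom.range_eq_top, hae]
    exact Ideal.Quotient.mk_surjective
  have : Algebra.IsAlgebraic (Algebra.adjoin K (Set.range x)) B := by
    constructor
    intro b
    have hb : b ∈ Algebra.adjoin K (Set.range x) := by
      rw [hsurj]; trivial
    exact isAlgebraic_algebraMap (⟨b, hb⟩ : Algebra.adjoin K (Set.range x))
  have hfs : FaithfulSMul K B := by
      exact (faithfulSMul_iff_algebraMap_injective K B).2 (algebraMap K B).injective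
  obtain ⟨t, ht, hb⟩ := exists_isTranscendenceBasis_subset (R := K) (Set.range x)
  have hfin : t.Finite := (Set.finite_range x).subset ht
  have : Fintype t := hfin.fintype
  choose ρ hρ using ht
  refine ⟨t, this, fun j => ρ j.2, ?_, ?_⟩
  · have : (fun j : t => (Ideal.Quotient.mkₐ K P (X (ρ j.2)))) = (fun j : t => (j : B)) := by
      funext j; exact hρ j.2
    rw [this]
    exact hb.1
  · have := hb.cardinalMk_eq_trdeg
    unfold pdim tdeg
    rw [← this]
    simp

theorem growth {K σ : Type} [Field K] [Finite σ] (P : Ideal (MvPolynomial σ K)) [hP : P.IsPrime] (n : ℕ) :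
    (n + pdim P).choose (pdim P) ≤ hfn P n := by
  obtain ⟨τ, _, ρ, hind, hcard⟩ := exists_indep P
  rw [← hcard, ← finrank_rtd (K := K) (σ := τ) n]
  have hcomp : aeval (fun j => (Ideal.Quotient.mkₐ K P (X (ρ j)))) = (Ideal.Quotient.mkₐ K P).comp (rename ρ) := by
    apply MvPolynomial.algHom_ext
    intro j
    simp
  have hinj : Function.Injective ((Ideal.Quotient.mkₐ K P).comp (rename ρ)).toLinearMap := by
    rw [← hcomp]; exact hind
  rw [(LinearEquiv.finrank_eq (Submodule.equivMapOfInjective _ hinj (restrictTotalDegree τ K n)))]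
  apply Submodule.finrank_mono
  rintro _ ⟨p, hp, rfl⟩
  refine ⟨rename ρ p, ?_, rfl⟩
  simp only [SetLike.mem_coe, mem_restrictTotalDegree] at *
  exact (totalDegree_rename_le _ _).trans hp

theorem cut {K σ : Type} [Field K] [Finite σ] (P : Ideal (MvPolynomial σ K)) [hP : P.IsPrime]
    (f : MvPolynomial σ K) (hf : f ∉ P) (b : ℕ) (hb : f.totalDegree ≤ b) (n : ℕ) :
    hfn (P ⊔ Ideal.span {f}) (n + b) + hfn P n ≤ hfn P (n + b) := by
  set I := P ⊔ Ideal.span {f} with hI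
  set W := (restrictTotalDegree σ K (n+b)).map (Ideal.Quotient.mkₐ K P).toLinearMap with hW
  set T := (restrictTotalDegree σ K n).map (Ideal.Quotient.mkₐ K P).toLinearMap with hT
  let φ : (MvPolynomial σ K ⧸ P) →ₗ[K] (MvPolynomial σ K ⧸ I) :=
    (Ideal.Quotient.factorₐ K (le_sup_left : P ≤ I)).toLinearMap
  have hφ : ∀ p, φ ((Ideal.Quotient.mkₐ K P).toLinearMap p) = (Ideal.Quotient.mkₐ K I).toLinearMap p := fun p => rfl
  have h1 := LinearMap.finrank_range_add_finrank_ker (φ.domRestrict W)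
  have h2 : LinearMap.range (φ.domRestrict W) = (restrictTotalDegree σ K (n+b)).map (Ideal.Quotient.mkₐ K I).toLinearMap := by
    rw [LinearMap.range_domRestrict, hW, ← Submodule.map_comp]
    rfl
  rw [h2] at h1
  have hfb : (Ideal.Quotient.mkₐ K P f) ≠ 0 := by
    intro h; exact hf (Ideal.Quotient.eq_zero_iff_mem.1 h)
  let μ : (MvPolynomial σ K ⧸ P) →ₗ[K] (MvPolynomial σ K ⧸ P) := LinearMap.mulLeft K (Ideal.Quotient.mkₐ K P f)
  have hμ : Function.Injective μ := by
    intro a b h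
    exact mul_left_cancel₀ hfb h
  have hTW : ∀ x : T, μ x ∈ W := by
    rintro ⟨_, p, hp, rfl⟩
    refine ⟨f * p, ?_, ?_⟩
    · simp only [SetLike.mem_coe, mem_restrictTotalDegree] at *
      have := totalDegree_mul f p
      omega
    · simp [μ]
  let θ : T →ₗ[K] LinearMap.ker (φ.domRestrict W) :=
    LinearMap.codRestrict _ (LinearMap.codRestrict W (μ.comp T.subtype) hTW) (by
      rintro ⟨_, p, hp, rfl⟩
      rw [LinearMap.mem_ker]
      rw [LinearMap.domRestrict_apply]
      change φ (μ ((Ideal.Quotient.mkₐ K P).toLinearMap p)) = 0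
      have : μ ((Ideal.Quotient.mkₐ K P).toLinearMap p) = (Ideal.Quotient.mkₐ K P).toLinearMap (f * p) := by
        simp [μ]
      rw [this, hφ]
      apply Ideal.Quotient.eq_zero_iff_mem.2
      exact Ideal.mul_mem_right _ _ (Ideal.mem_sup_right (Ideal.mem_span_singleton_self f)))
  have hθ : Function.Injective θ := by
    intro a b h
    apply Subtype.ext
    apply hμ
    have h' := congrArg Subtype.val (congrArg Subtype.val h)
    exact h'
  have h3 := LinearMap.finrank_le_finrank_of_injective hθ
  unfold hfn
  rw [← hW, ← hT]
  omega

theorem sum_growth {K σ : Type} [Field K] [Finite σ] {J : Type} [Fintype J] (I : Ideal (MvPolynomial σ K))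
    (P : J → Ideal (MvPolynomial σ K)) (hP : ∀ j, (P j).IsPrime) (hI : ∀ j, I ≤ P j)
    (f : J → MvPolynomial σ K) (hf : ∀ j, f j ∉ P j) (hf' : ∀ i j, i ≠ j → f j ∈ P i)
    (c : ℕ) (hc : ∀ j, (f j).totalDegree ≤ c) (n : ℕ) :
    ∑ j, hfn (P j) n ≤ hfn I (n + c) := by
  classical
  set W := (restrictTotalDegree σ K (n+c)).map (Ideal.Quotient.mkₐ K I).toLinearMap with hW
  let T : ∀ j, Submodule K (MvPolynomial σ K ⧸ P j) := fun j => (restrictTotalDegree σ K n).map (Ideal.Quotient.mkₐ K (P j)).toLinearMap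
  let ψ : (MvPolynomial σ K ⧸ I) →ₗ[K] (∀ j, MvPolynomial σ K ⧸ P j) :=
    LinearMap.pi (fun j => (Ideal.Quotient.factorₐ K (hI j)).toLinearMap)
  let θ : (∀ j, T j) →ₗ[K] (∀ j, MvPolynomial σ K ⧸ P j) :=
    LinearMap.pi (fun j => (LinearMap.mulLeft K (Ideal.Quotient.mkₐ K (P j) (f j))).comp ((T j).subtype.comp (LinearMap.proj j)))
  have hθ : Function.Injective θ := by
    intro a b h
    funext j
    apply Subtype.ext
    have := congrFun h j
    have hfb : (Ideal.Quotient.mkₐ K (P j) (f j)) ≠ 0 := by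
      intro h; exact hf j (Ideal.Quotient.eq_zero_iff_mem.1 h)
    exact mul_left_cancel₀ hfb this
  have h1 := LinearMap.finrank_range_of_inj hθ
  have : ∀ j, Module.Free K (T j) := fun j => Module.Free.of_divisionRing K _
  have : ∀ j, Module.Finite K (T j) := fun j => inferInstance
  rw [Module.finrank_pi_fintype] at h1
  have h2 : LinearMap.range θ ≤ W.map ψ := by
    rintro _ ⟨a, rfl⟩
    have h3 : ∀ j, ∃ p, p ∈ restrictTotalDegree σ K n ∧ Ideal.Quotient.mkₐ K (P j) p = (a j : MvPolynomial σ K ⧸ P j) := by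
      intro j
      obtain ⟨p, hp, h⟩ := (a j).2
      exact ⟨p, hp, h⟩
    choose p hp hpa using h3
    refine ⟨Ideal.Quotient.mkₐ K I (∑ j, f j * p j), ⟨∑ j, f j * p j, ?_, rfl⟩, ?_⟩
    · simp only [SetLike.mem_coe]
      apply Submodule.sum_mem
      intro j _
      have := hp j
      simp only [mem_restrictTotalDegree] at *
      have := totalDegree_mul (f j) (p j)
      have := hc j
      omega
    · funext i
      show Ideal.Quotient.mkₐ K (P i) (∑ j, f j * p j) = Ideal.Quotient.mkₐ K (P i) (f i) * (a i : MvPolynomial σ K ⧸ P i)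
      rw [← hpa i, ← map_mul, map_sum, Finset.sum_eq_single i]
      · intro j _ hj
        apply Ideal.Quotient.eq_zero_iff_mem.2
        exact Ideal.mul_mem_right _ _ (hf' i j (Ne.symm hj))
      · simp
  calc ∑ j, hfn (P j) n = Module.finrank K (LinearMap.range θ) := h1.symm
    _ ≤ Module.finrank K (W.map ψ) := Submodule.finrank_mono h2
    _ ≤ _ := Submodule.finrank_map_le _ _


def Gr {K σ : Type} [Field K] (I : Ideal (MvPolynomial σ K)) (d : ℕ) (e : ℝ) : Prop :=
  ∃ c : ℕ, ∀ n : ℕ, e * ((n + d).choose d : ℕ) ≤ hfn I (n + c)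

theorem choose_aux (d m k : ℕ) : (m + k + d + 1).choose (d + 1) ≤
    (m + d + 1).choose (d + 1) + k * (m + k + d).choose d := by
  induction k with
  | zero => simp
  | succ k ih =>
    have h1 : (m + (k+1) + d + 1).choose (d + 1) = (m + (k+1) + d).choose d + (m + k + d + 1).choose (d+1) := by
      rw [Nat.choose_succ_succ]
      congr 2
      omega
    have h2 : (m + k + d).choose d ≤ (m + (k+1) + d).choose d := Nat.choose_le_choose _ (by omega)
    have h3 := Nat.mul_le_mul_left k h2
    rw [h1, add_mul]
    omega

theorem gr_cut {K σ : Type} [Field K] [Finite σ] (P : Ideal (MvPolynomial σ K)) [hP : P.IsPrime]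
    (f : MvPolynomial σ K) (hf : f ∉ P) (b : ℕ) (hb1 : 1 ≤ b) (hb : f.totalDegree ≤ b) (d : ℕ) (e : ℝ)
    (he : 0 ≤ e) (h : Gr (P ⊔ Ideal.span {f}) d e) : Gr P (d + 1) (e / b) := by
  obtain ⟨c, hc⟩ := h
  refine ⟨c, ?_⟩
  have hb0 : (0:ℝ) < b := by exact_mod_cast hb1
  suffices H : ∀ N : ℕ, e * ((N + (d+1)).choose (d+1) : ℕ) ≤ b * hfn P (N + c) by
    intro n
    have := H n
    rw [div_mul_eq_mul_div, div_le_iff₀ hb0]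
    linarith
  have hcut0 : ∀ N, hfn (P ⊔ Ideal.span {f}) N ≤ hfn P N := by
    intro N
    by_cases hN : b ≤ N
    · have := cut P f hf b hb (N - b)
      rw [Nat.sub_add_cancel hN] at this
      omega
    · unfold hfn
      have : (restrictTotalDegree σ K N).map (Ideal.Quotient.mkₐ K (P ⊔ Ideal.span {f})).toLinearMap
        = ((restrictTotalDegree σ K N).map (Ideal.Quotient.mkₐ K P).toLinearMap).map
          (Ideal.Quotient.factorₐ K (le_sup_left : P ≤ P ⊔ Ideal.span {f})).toLinearMap := by
        rw [← Submodule.map_comp]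
        rfl
      rw [this]
      exact Submodule.finrank_map_le _ _
  intro N
  induction N using Nat.strong_induction_on with
  | _ N ih =>
    by_cases hN : b ≤ N
    · obtain ⟨m, rfl⟩ := Nat.exists_eq_add_of_le' hN
      have h1 := ih m (by omega)
      have h2 := hc (m + b)
      have h3 := cut P f hf b hb (m + c)
      have h4 := choose_aux d m b
      have h3' : (hfn (P ⊔ Ideal.span {f}) (m + b + c) : ℝ) + hfn P (m + c) ≤ hfn P (m + b + c) := by
        rw [show m + b + c = m + c + b by omega]
        exact_mod_cast h3
      have h4' : (((m + b + (d + 1)).choose (d+1) : ℕ) : ℝ) ≤ ((m + (d + 1)).choose (d + 1) : ℕ) + b * ((m + b + d).choose d : ℕ) := by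
        exact_mod_cast h4
      nlinarith [mul_le_mul_of_nonneg_left h4' he, mul_le_mul_of_nonneg_left h3' hb0.le, mul_le_mul_of_nonneg_left h2 hb0.le]
    · have h4 := choose_aux d 0 N
      have h5 : 1 ≤ (N + d).choose d := Nat.choose_pos (by omega)
      have h6 : (N + (d + 1)).choose (d + 1) ≤ b * (N + d).choose d := by
        simp only [zero_add, Nat.choose_self] at h4
        calc (N + (d + 1)).choose (d + 1) ≤ 1 + N * (N+d).choose d := h4
          _ ≤ (N+1) * (N+d).choose d := by rw [add_mul]; omega
          _ ≤ _ := Nat.mul_le_mul_right _ (by omega)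
      have h6' : (((N + (d + 1)).choose (d + 1) : ℕ) : ℝ) ≤ b * ((N + d).choose d : ℕ) := by exact_mod_cast h6
      have h2 := hc N
      have h7 : (hfn (P ⊔ Ideal.span {f}) (N + c) : ℝ) ≤ hfn P (N + c) := by exact_mod_cast hcut0 _
      nlinarith [mul_le_mul_of_nonneg_left h6' he, mul_le_mul_of_nonneg_left h2 hb0.le, mul_le_mul_of_nonneg_left h7 hb0.le]

theorem gr_sum {K σ : Type} [Field K] [Finite σ] (I : Ideal (MvPolynomial σ K)) (d : ℕ)
    (S : Finset (Ideal (MvPolynomial σ K))) (hS : ∀ Q ∈ S, Q ∈ I.minimalPrimes)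
    (e : Ideal (MvPolynomial σ K) → ℝ) (he : ∀ Q ∈ S, 0 ≤ e Q) (h : ∀ Q ∈ S, Gr Q d (e Q)) :
    Gr I d (∑ Q ∈ S, e Q) := by
  classical
  have h1 : ∀ Q : S, ∃ f, f ∉ Q.1 ∧ ∀ Q' : S, Q' ≠ Q → f ∈ Q'.1 := by
    intro Q
    have hQp : Q.1.IsPrime := (hS Q.1 Q.2).1.1
    have : ¬ ((S.erase Q.1).inf id ≤ Q.1) := by
      intro hle
      obtain ⟨Q', hQ', hle'⟩ := (Ideal.IsPrime.inf_le' hQp).1 hle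
      rw [Finset.mem_erase] at hQ'
      have hQS := hS Q' hQ'.2
      have := (hS Q.1 Q.2).2 hQS.1 hle'
      exact hQ'.1 (le_antisymm hle' this)
    obtain ⟨f, hf1, hf2⟩ := Set.not_subset.1 this
    refine ⟨f, hf2, ?_⟩
    intro Q' hQ'
    have h3 : (S.erase Q.1).inf id ≤ Q'.1 := Finset.inf_le (f := id) (Finset.mem_erase.2 ⟨fun h => hQ' (Subtype.ext h), Q'.2⟩)
    exact h3 hf1
  choose f hf hf' using h1
  have h2 : ∀ Q : S, ∃ c : ℕ, ∀ n : ℕ, e Q.1 * ((n + d).choose d : ℕ) ≤ hfn Q.1 (n + c) := fun Q => h Q.1 Q.2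
  choose c hc using h2
  refine ⟨(∑ Q, c Q) + ∑ Q, (f Q).totalDegree, ?_⟩
  intro n
  have h3 := sum_growth I (fun Q : S => Q.1) (fun Q => (hS Q.1 Q.2).1.1) (fun Q => (hS Q.1 Q.2).1.2) f hf
    (fun i j hij => hf' j i hij) (∑ Q, (f Q).totalDegree)
    (fun Q => Finset.single_le_sum (f := fun Q => (f Q).totalDegree) (fun _ _ => Nat.zero_le _) (Finset.mem_univ Q)) (n + ∑ Q, c Q)
  rw [add_assoc] at h3
  have h4 : ((∑ Q : S, hfn Q.1 (n + ∑ Q, c Q) : ℕ) : ℝ) ≤ hfn I (n + (∑ Q, c Q + ∑ Q, (f Q).totalDegree)) := by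
    exact_mod_cast h3
  refine le_trans ?_ h4
  rw [← Finset.sum_coe_sort S, Finset.sum_mul]
  push_cast
  apply Finset.sum_le_sum
  intro Q _
  refine (hc Q n).trans ?_
  have : hfn Q.1 (n + c Q) ≤ hfn Q.1 (n + ∑ Q, c Q) := by
    apply hfn_mono
    have := Finset.single_le_sum (f := fun Q => c Q) (fun _ _ => Nat.zero_le _) (Finset.mem_univ Q)
    omega
  exact_mod_cast this

noncomputable def cutPrimes {K σ : Type} [Field K] [Finite σ] (P : Ideal (MvPolynomial σ K))
    (f : MvPolynomial σ K) : Finset (Ideal (MvPolynomial σ K)) :=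
  (Ideal.finite_minimalPrimes_of_isNoetherianRing _ (P ⊔ Ideal.span {f})).toFinset

theorem mem_cutPrimes {K σ : Type} [Field K] [Finite σ] {P : Ideal (MvPolynomial σ K)}
    {f : MvPolynomial σ K} {Q} : Q ∈ cutPrimes P f ↔ Q ∈ (P ⊔ Ideal.span {f}).minimalPrimes := by
  simp [cutPrimes]

theorem gr_zero {K σ : Type} [Field K] (P : Ideal (MvPolynomial σ K)) (d : ℕ) : Gr P d 0 :=
  ⟨0, fun n => by simp⟩

theorem gr_one {K σ : Type} [Field K] [Finite σ] (P : Ideal (MvPolynomial σ K)) [P.IsPrime] : Gr P (pdim P) 1 :=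
  ⟨0, fun n => by rw [one_mul]; exact_mod_cast growth P n⟩

theorem lemmaK {K σ : Type} [Field K] [Finite σ] (P : Ideal (MvPolynomial σ K)) [hP : P.IsPrime]
    (f : MvPolynomial σ K) (hf : f ∉ P) (b : ℕ) (hb1 : 1 ≤ b) (hb : f.totalDegree ≤ b)
    (e : Ideal (MvPolynomial σ K) → ℝ) (he : ∀ Q ∈ cutPrimes P f, 0 ≤ e Q)
    (h : ∀ Q ∈ cutPrimes P f, Gr Q (pdim Q) (e Q)) :
    Gr P (pdim P) ((∑ Q ∈ cutPrimes P f, e Q) / b) := by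
  rcases (cutPrimes P f).eq_empty_or_nonempty with h0 | ⟨Q, hQ⟩
  · rw [h0]; simpa using gr_zero P _
  · have h1 := pdim_drop P hf Q (mem_cutPrimes.1 hQ)
    rw [← h1]
    apply gr_cut P f hf b hb1 hb _ _ (Finset.sum_nonneg he)
    apply gr_sum _ _ _ (fun Q hQ => mem_cutPrimes.1 hQ) e he
    intro Q' hQ'
    have h2 := pdim_drop P hf Q' (mem_cutPrimes.1 hQ')
    have := h Q' hQ'
    rwa [show pdim Q' = pdim Q by omega] at this

theorem choose_scale (L D n : ℕ) (hD : 1 ≤ D): (n * D + L).choose L ≤ D ^ L * (n + L).choose L := by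
  induction L with
  | zero => simp
  | succ L ih =>
    have h1 := Nat.add_one_mul_choose_eq (n * D + L) L
    have h2 := Nat.add_one_mul_choose_eq (n + L) L
    have h3 : n * D + L + 1 ≤ D * (n + L + 1) := by nlinarith
    have : (n * D + L + 1).choose (L+1) * (L+1) ≤ (D^(L+1) * (n + L + 1).choose (L+1)) * (L+1) := by
      rw [← h1, mul_assoc, ← h2]
      calc (n * D + L + 1) * (n * D + L).choose L ≤ (D * (n + L + 1)) * (D ^ L * (n + L).choose L) := Nat.mul_le_mul h3 ih
        _ = _ := by ring
    exact Nat.le_of_mul_le_mul_right this (by omega)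

theorem choose_ratio (L c : ℕ) : Filter.Tendsto
    (fun n : ℕ => (((n + c + L).choose L : ℕ) : ℝ) / ((n + L).choose L : ℕ)) Filter.atTop (nhds 1) := by
  induction L with
  | zero => simp
  | succ L ih =>
    have h0 : Filter.Tendsto (fun n : ℕ => (1:ℝ) + c / ((n:ℝ) + (L + 1))) Filter.atTop (nhds (1 + 0)) := by
      apply Filter.Tendsto.add tendsto_const_nhds
      apply Filter.Tendsto.div_atTop tendsto_const_nhds
      apply Filter.tendsto_atTop_add_const_right
      exact tendsto_natCast_atTop_atTop
    have := h0.mul ih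
    rw [add_zero, one_mul] at this
    refine this.congr ?_
    intro n
    have h1 : ((n:ℝ) + c + L + 1) * ((n + c + L).choose L : ℕ) = ((n + c + (L+1)).choose (L+1) : ℕ) * (L + 1) := by
      exact_mod_cast Nat.add_one_mul_choose_eq (n + c + L) L
    have h2 : ((n:ℝ) + L + 1) * ((n + L).choose L : ℕ) = ((n + (L+1)).choose (L+1) : ℕ) * (L + 1) := by
      exact_mod_cast Nat.add_one_mul_choose_eq (n + L) L
    have p1 : (0:ℝ) < ((n + L).choose L : ℕ) := by exact_mod_cast Nat.choose_pos (by omega)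
    have p2 : (0:ℝ) < ((n + (L + 1)).choose (L+1) : ℕ) := by exact_mod_cast Nat.choose_pos (by omega)
    have p3 : (0:ℝ) < (n:ℝ) + (L + 1) := by positivity
    have p4 : (0:ℝ) < (L:ℝ) + 1 := by positivity
    have e1 : (((n + c + (L+1)).choose (L+1) : ℕ) : ℝ) = ((n:ℝ) + c + L + 1) * ((n + c + L).choose L : ℕ) / (L + 1) := by
      rw [h1]; field_simp
    have e2 : (((n + (L+1)).choose (L+1) : ℕ) : ℝ) = ((n:ℝ) + L + 1) * ((n + L).choose L : ℕ) / (L + 1) := by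
      rw [h2]; field_simp
    rw [e1, e2]
    have p5 : (0:ℝ) < (n:ℝ) + L + 1 := by positivity
    field_simp
    ring

theorem asym (L D : ℕ) (hD : 1 ≤ D) (e : ℝ) (c : ℕ)
    (h : ∀ n : ℕ, e * ((n + L).choose L : ℕ) ≤ (((n + c) * D + L).choose L : ℕ)) : e ≤ (D : ℝ) ^ L := by
  have h1 := (choose_ratio L c).const_mul ((D:ℝ)^L)
  rw [mul_one] at h1
  refine ge_of_tendsto' h1 ?_
  intro n
  have p1 : (0:ℝ) < ((n + L).choose L : ℕ) := by exact_mod_cast Nat.choose_pos (by omega)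
  rw [← mul_div_assoc, le_div_iff₀ p1]
  refine (h n).trans ?_
  exact_mod_cast choose_scale L D (n + c) hD

theorem pdim_bot {K σ : Type} [Field K] [Fintype σ] : pdim (⊥ : Ideal (MvPolynomial σ K)) = Fintype.card σ := by
  unfold pdim tdeg
  rw [AlgEquiv.trdeg_eq (AlgEquiv.quotientBot K (MvPolynomial σ K))]
  simp

theorem gr_bot_le {K σ : Type} [Field K] [Fintype σ] (e : ℝ)
    (h : Gr (⊥ : Ideal (MvPolynomial σ K)) (pdim (⊥ : Ideal (MvPolynomial σ K))) e) : e ≤ 1 := by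
  rw [pdim_bot] at h
  obtain ⟨c, hc⟩ := h
  have := asym (Fintype.card σ) 1 le_rfl e c (by
    intro n
    refine (hc n).trans ?_
    rw [mul_one]
    exact_mod_cast hfn_le _ _)
  simpa using this


open Classical in
noncomputable def cn {Γ : Type} [Fintype Γ] (p : Γ → Prop) : ℕ := (Finset.univ.filter p).card

theorem cn_le_sum {Γ J : Type} [Fintype Γ] (s : Finset J) (p : Γ → Prop) (r : J → Γ → Prop)
    (h : ∀ x, p x → ∃ j ∈ s, r j x) : cn p ≤ ∑ j ∈ s, cn (r j) := by
  classical
  unfold cn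
  refine le_trans (Finset.card_le_card ?_) Finset.card_biUnion_le
  intro x hx
  simp only [Finset.mem_filter, Finset.mem_univ, true_and, Finset.mem_biUnion] at *
  exact h x hx

theorem cn_mono {Γ : Type} [Fintype Γ] (p r : Γ → Prop) (h : ∀ x, p x → r x) : cn p ≤ cn r := by
  classical
  unfold cn
  apply Finset.card_le_card
  intro x hx
  simp only [Finset.mem_filter, Finset.mem_univ, true_and] at *
  exact h x hx

theorem cn_or {Γ : Type} [Fintype Γ] (p r r' : Γ → Prop) (h : ∀ x, p x → r x ∨ r' x) : cn p ≤ cn r + cn r' := by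
  classical
  unfold cn
  refine le_trans (Finset.card_le_card ?_) (Finset.card_union_le _ _)
  intro x hx
  simp only [Finset.mem_filter, Finset.mem_univ, true_and, Finset.mem_union] at *
  exact h x hx

theorem cn_le_one {Γ : Type} [Fintype Γ] (p : Γ → Prop) (h : ∀ x y, p x → p y → x = y) : cn p ≤ 1 := by
  classical
  unfold cn
  rw [Finset.card_le_one]
  intro a ha b hb
  simp only [Finset.mem_filter, Finset.mem_univ, true_and] at *
  exact h a b ha hb

theorem cn_false {Γ : Type} [Fintype Γ] (p : Γ → Prop) (h : ∀ x, ¬ p x) : cn p = 0 := by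
  classical
  unfold cn
  rw [Finset.card_eq_zero, Finset.filter_eq_empty_iff]
  intro x _
  exact h x

def IsZ {K σ : Type} [Field K] (I : Ideal (MvPolynomial σ K)) (y : σ → K) : Prop := ∀ f ∈ I, eval y f = 0

theorem isZ_split {K σ : Type} [Field K] [Finite σ] {P : Ideal (MvPolynomial σ K)} {f : MvPolynomial σ K}
    {y : σ → K} (hy : IsZ P y) (hf : eval y f = 0) : ∃ Q ∈ cutPrimes P f, IsZ Q y := by
  have hp : (RingHom.ker (eval y)).IsPrime := RingHom.ker_isPrime _
  have hle : P ⊔ Ideal.span {f} ≤ RingHom.ker (eval y) := by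
    apply sup_le
    · intro g hg; exact hy g hg
    · rw [Ideal.span_singleton_le_iff_mem]; exact hf
  obtain ⟨Q, hQ, hQle⟩ := Ideal.exists_minimalPrimes_le hle
  exact ⟨Q, mem_cutPrimes.2 hQ, fun g hg => hQle hg⟩

theorem grid_prime {K σ T : Type} [Field K] [Fintype σ] [DecidableEq σ] [Fintype T] [Nonempty T] (φ : T → K) (hφ : Function.Injective φ) :
    ∀ (d : ℕ) (P : Ideal (MvPolynomial σ K)), P.IsPrime → pdim P = d →
    ∃ e : ℝ, 0 ≤ e ∧ Gr P (pdim P) e ∧ (cn (fun y : σ → T => IsZ P (φ ∘ y)) : ℝ) ≤ e * (Fintype.card T : ℝ) ^ pdim P := by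
  intro d
  induction d using Nat.strong_induction_on with
  | _ d ih =>
  intro P hP hd
  have hq : (1:ℝ) ≤ Fintype.card T := by exact_mod_cast Fintype.card_pos
  by_cases hc : ∃ i, ∀ a : T, X i - C (φ a) ∉ P
  · obtain ⟨i, hi⟩ := hc
    have h1 : ∀ Q : Ideal (MvPolynomial σ K), ∃ e : ℝ, (∃ a, Q ∈ cutPrimes P (X i - C (φ a))) → 0 ≤ e ∧ Gr Q (pdim Q) e ∧
        (Fintype.card T : ℝ) * (cn (fun y : σ → T => IsZ Q (φ ∘ y)) : ℝ) ≤ e * (Fintype.card T : ℝ) ^ pdim P := by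
      intro Q
      by_cases hQ : ∃ a, Q ∈ cutPrimes P (X i - C (φ a))
      · obtain ⟨a, ha⟩ := hQ
        have h2 := pdim_drop P (hi a) Q (mem_cutPrimes.1 ha)
        obtain ⟨e, he, hg, hcn⟩ := ih (pdim Q) (by omega) Q (mem_cutPrimes.1 ha).1.1 rfl
        refine ⟨e, fun _ => ⟨he, hg, ?_⟩⟩
        rw [← h2, pow_succ]
        nlinarith
      · exact ⟨0, fun h => absurd h hQ⟩
    choose e he using h1
    let E : T → ℝ := fun a => ∑ Q ∈ cutPrimes P (X i - C (φ a)), e Q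
    obtain ⟨a0, ha0⟩ := Finite.exists_max E
    refine ⟨E a0, Finset.sum_nonneg (fun Q hQ => (he Q ⟨a0, hQ⟩).1), ?_, ?_⟩
    · have := lemmaK P (X i - C (φ a0)) (hi a0) 1 le_rfl (by
        refine (totalDegree_sub _ _).trans ?_
        simp [totalDegree_X]) e (fun Q hQ => (he Q ⟨a0, hQ⟩).1) (fun Q hQ => (he Q ⟨a0, hQ⟩).2.1)
      simpa using this
    · have h3 : cn (fun y : σ → T => IsZ P (φ ∘ y)) ≤ ∑ a : T, ∑ Q ∈ cutPrimes P (X i - C (φ a)), cn (fun y : σ → T => IsZ Q (φ ∘ y)) := by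
        refine (cn_le_sum Finset.univ _ (fun a (y : σ → T) => IsZ P (φ ∘ y) ∧ y i = a) ?_).trans ?_
        · intro y hy
          exact ⟨y i, Finset.mem_univ _, hy, rfl⟩
        · apply Finset.sum_le_sum
          intro a _
          apply cn_le_sum
          rintro y ⟨hy, rfl⟩
          exact isZ_split hy (by simp)
      have h4 : (Fintype.card T : ℝ) * (cn (fun y : σ → T => IsZ P (φ ∘ y)) : ℝ) ≤ (Fintype.card T : ℝ) * (E a0 * (Fintype.card T : ℝ) ^ pdim P) := by
        calc (Fintype.card T : ℝ) * (cn (fun y : σ → T => IsZ P (φ ∘ y)) : ℝ)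
            ≤ (Fintype.card T : ℝ) * ∑ a : T, ∑ Q ∈ cutPrimes P (X i - C (φ a)), (cn (fun y : σ → T => IsZ Q (φ ∘ y)) : ℝ) := by
              apply mul_le_mul_of_nonneg_left _ (by linarith)
              exact_mod_cast h3
          _ = ∑ a : T, ∑ Q ∈ cutPrimes P (X i - C (φ a)), (Fintype.card T : ℝ) * (cn (fun y : σ → T => IsZ Q (φ ∘ y)) : ℝ) := by
              simp only [Finset.mul_sum]
          _ ≤ ∑ a : T, ∑ Q ∈ cutPrimes P (X i - C (φ a)), e Q * (Fintype.card T : ℝ) ^ pdim P := by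
              apply Finset.sum_le_sum; intro a _
              apply Finset.sum_le_sum; intro Q hQ
              exact (he Q ⟨a, hQ⟩).2.2
          _ = ∑ a : T, E a * (Fintype.card T : ℝ) ^ pdim P := by
              simp only [E, Finset.sum_mul]
          _ ≤ ∑ a : T, E a0 * (Fintype.card T : ℝ) ^ pdim P := by
              apply Finset.sum_le_sum; intro a _
              exact mul_le_mul_of_nonneg_right (ha0 a) (by positivity)
          _ = _ := by simp
      exact le_of_mul_le_mul_left h4 (by linarith)
  · push Not at hc
    choose a ha using hc
    refine ⟨1, zero_le_one, gr_one P, ?_⟩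
    have h1 : cn (fun y : σ → T => IsZ P (φ ∘ y)) ≤ 1 := by
      apply cn_le_one
      intro x y hx hy
      funext i
      have h2 := hx _ (ha i)
      have h3 := hy _ (ha i)
      simp only [map_sub, eval_X, eval_C, Function.comp, sub_eq_zero] at h2 h3
      exact hφ (h2.trans h3.symm)
    have h2 : (1:ℝ) ≤ (Fintype.card T : ℝ) ^ pdim P := one_le_pow₀ hq
    have h1' : (cn (fun y : σ → T => IsZ P (φ ∘ y)) : ℝ) ≤ 1 := by exact_mod_cast h1
    linarith

theorem irr_count {K σ T : Type} [Field K] [Fintype σ] [DecidableEq σ] [Fintype T] [Nonempty T] (φ : T → K) (hφ : Function.Injective φ)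
    (p B : MvPolynomial σ K) (hp : Irreducible p) (hB : ¬ p ∣ B) (b : ℕ) (hb1 : 1 ≤ b) (hb : B.totalDegree ≤ b) :
    (cn (fun y : σ → T => eval (φ ∘ y) p = 0 ∧ eval (φ ∘ y) B = 0) : ℝ) * (Fintype.card T : ℝ) ^ 2 ≤
      p.totalDegree * b * (Fintype.card T : ℝ) ^ Fintype.card σ := by
  have hq : (1:ℝ) ≤ Fintype.card T := by exact_mod_cast Fintype.card_pos
  have hpp : Prime p := hp.prime
  set P := Ideal.span {p} with hPdef
  have hP : P.IsPrime := (Ideal.span_singleton_prime hpp.ne_zero).2 hpp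
  have hcp : cutPrimes ⊥ p = {P} := by
    ext Q
    rw [mem_cutPrimes, bot_sup_eq, Ideal.minimalPrimes_eq_subsingleton_self, Finset.mem_singleton, Set.mem_singleton_iff]
  have hbotP : (⊥ : Ideal (MvPolynomial σ K)).IsPrime := Ideal.isPrime_bot
  have hpb : p ∉ (⊥ : Ideal (MvPolynomial σ K)) := by
    rw [Ideal.mem_bot]; exact hpp.ne_zero
  have hd1 : pdim P + 1 = Fintype.card σ := by
    rw [← pdim_bot (K := K)]
    exact pdim_drop ⊥ hpb P (mem_cutPrimes.1 (by rw [hcp]; simp))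
  have hBP : B ∉ P := by rwa [hPdef, Ideal.mem_span_singleton]
  have h1 : ∀ Q : Ideal (MvPolynomial σ K), ∃ e : ℝ, Q ∈ cutPrimes P B → 0 ≤ e ∧ Gr Q (pdim Q) e ∧
        (cn (fun y : σ → T => IsZ Q (φ ∘ y)) : ℝ) * (Fintype.card T : ℝ) ^ 2 ≤ e * (Fintype.card T : ℝ) ^ Fintype.card σ := by
    intro Q
    by_cases hQ : Q ∈ cutPrimes P B
    · have h2 := pdim_drop P hBP Q (mem_cutPrimes.1 hQ)
      obtain ⟨e, he, hg, hcn⟩ := grid_prime φ hφ (pdim Q) Q (mem_cutPrimes.1 hQ).1.1 rfl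
      refine ⟨e, fun _ => ⟨he, hg, ?_⟩⟩
      rw [← hd1, ← h2, add_assoc, pow_add, ← mul_assoc]
      exact mul_le_mul_of_nonneg_right hcn (by positivity)
    · exact ⟨0, fun h => absurd h hQ⟩
  choose e he using h1
  have hdeg1 : 1 ≤ p.totalDegree := by
    by_contra h
    have h1 : p.totalDegree = 0 := by omega
    rw [totalDegree_eq_zero_iff_eq_C] at h1
    have h2 : coeff 0 p ≠ 0 := by
      intro h3; apply hpp.ne_zero; rw [h1, h3, C_0]
    apply hpp.not_isUnit
    rw [h1]
    exact (IsUnit.mk0 _ h2).map C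
  have hE0 : 0 ≤ ∑ Q ∈ cutPrimes P B, e Q := Finset.sum_nonneg (fun Q hQ => (he Q hQ).1)
  have hg1 := lemmaK P B hBP b hb1 hb e (fun Q hQ => (he Q hQ).1) (fun Q hQ => (he Q hQ).2.1)
  have hg2 := lemmaK ⊥ p hpb p.totalDegree hdeg1 le_rfl (fun _ => (∑ Q ∈ cutPrimes P B, e Q) / b)
    (fun _ _ => by positivity) (by
      intro Q hQ
      rw [hcp, Finset.mem_singleton] at hQ
      rw [hQ]; exact hg1)
  rw [hcp, Finset.sum_singleton] at hg2
  have hle := gr_bot_le _ hg2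
  have hb0 : (0:ℝ) < b := by exact_mod_cast hb1
  have hp0 : (0:ℝ) < p.totalDegree := by exact_mod_cast hdeg1
  rw [div_div, div_le_one (by positivity)] at hle
  have h5 : cn (fun y : σ → T => eval (φ ∘ y) p = 0 ∧ eval (φ ∘ y) B = 0) ≤ ∑ Q ∈ cutPrimes P B, cn (fun y : σ → T => IsZ Q (φ ∘ y)) := by
    apply cn_le_sum
    rintro y ⟨hy1, hy2⟩
    apply isZ_split _ hy2
    intro f hf
    rw [hPdef, Ideal.mem_span_singleton] at hf
    obtain ⟨g, rfl⟩ := hf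
    rw [map_mul, hy1, zero_mul]
  calc (cn (fun y : σ → T => eval (φ ∘ y) p = 0 ∧ eval (φ ∘ y) B = 0) : ℝ) * (Fintype.card T : ℝ) ^ 2
      ≤ (∑ Q ∈ cutPrimes P B, (cn (fun y : σ → T => IsZ Q (φ ∘ y)) : ℝ)) * (Fintype.card T : ℝ) ^ 2 := by
        apply mul_le_mul_of_nonneg_right _ (by positivity)
        exact_mod_cast h5
    _ = ∑ Q ∈ cutPrimes P B, (cn (fun y : σ → T => IsZ Q (φ ∘ y)) : ℝ) * (Fintype.card T : ℝ) ^ 2 := by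
        rw [Finset.sum_mul]
    _ ≤ ∑ Q ∈ cutPrimes P B, e Q * (Fintype.card T : ℝ) ^ Fintype.card σ := 
        Finset.sum_le_sum (fun Q hQ => (he Q hQ).2.2)
    _ = (∑ Q ∈ cutPrimes P B, e Q) * (Fintype.card T : ℝ) ^ Fintype.card σ := by rw [Finset.sum_mul]
    _ ≤ _ := by
        apply mul_le_mul_of_nonneg_right _ (by positivity)
        linarith

theorem coprime_count {K σ T : Type} [Field K] [Fintype σ] [DecidableEq σ] [Fintype T] [Nonempty T] (φ : T → K) (hφ : Function.Injective φ)
    (B' : MvPolynomial σ K) (b : ℕ) (hb1 : 1 ≤ b) (hb : B'.totalDegree ≤ b) (B : MvPolynomial σ K) :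
    B ≠ 0 → IsRelPrime B B' →
    (cn (fun y : σ → T => eval (φ ∘ y) B = 0 ∧ eval (φ ∘ y) B' = 0) : ℝ) * (Fintype.card T : ℝ) ^ 2 ≤
      B.totalDegree * b * (Fintype.card T : ℝ) ^ Fintype.card σ := by
  induction B using WfDvdMonoid.induction_on_irreducible with
  | zero => intro h; exact absurd rfl h
  | unit u hu =>
    intro _ _
    rw [cn_false]
    · simp only [Nat.cast_zero, zero_mul]; positivity
    · rintro y ⟨hy, _⟩
      have := hu.map (eval (φ ∘ y))
      rw [hy] at this
      exact not_isUnit_zero this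
  | mul a p ha hp ih =>
    intro h0 hrel
    have h1 := ih ha (hrel.of_mul_left_right)
    have h2 := irr_count φ hφ p B' hp (fun hdvd => hp.not_isUnit ((hrel.of_mul_left_left) (dvd_refl p) hdvd)) b hb1 hb
    have h3 : cn (fun y : σ → T => eval (φ ∘ y) (p * a) = 0 ∧ eval (φ ∘ y) B' = 0) ≤
      cn (fun y : σ → T => eval (φ ∘ y) p = 0 ∧ eval (φ ∘ y) B' = 0) + cn (fun y : σ → T => eval (φ ∘ y) a = 0 ∧ eval (φ ∘ y) B' = 0) := by
      apply cn_or
      rintro y ⟨hy, hy'⟩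
      rw [map_mul, mul_eq_zero] at hy
      tauto
    have h3' : (cn (fun y : σ → T => eval (φ ∘ y) (p * a) = 0 ∧ eval (φ ∘ y) B' = 0) : ℝ) ≤
      cn (fun y : σ → T => eval (φ ∘ y) p = 0 ∧ eval (φ ∘ y) B' = 0) + cn (fun y : σ → T => eval (φ ∘ y) a = 0 ∧ eval (φ ∘ y) B' = 0) := by
      exact_mod_cast h3
    rw [totalDegree_mul_of_isDomain hp.ne_zero ha]
    push_cast
    have h4 := mul_le_mul_of_nonneg_right h3' (by positivity : (0:ℝ) ≤ (Fintype.card T : ℝ) ^ 2)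
    linarith

theorem sz {K T : Type} [Field K] {t : ℕ} [Fintype T] [Nonempty T] (φ : T → K) (hφ : Function.Injective φ)
    (F : MvPolynomial (Fin t) K) (hF : F ≠ 0) :
    (cn (fun y : Fin t → T => eval (φ ∘ y) F = 0) : ℝ) * (Fintype.card T : ℝ) ≤ F.totalDegree * (Fintype.card T : ℝ) ^ t := by
  classical
  have h := schwartz_zippel_totalDegree hF (Finset.univ.image φ)
  rw [Finset.card_image_of_injective _ hφ, Finset.card_univ] at h
  have h1 : cn (fun y : Fin t → T => eval (φ ∘ y) F = 0) =
     (Finset.filter (fun f => eval f F = 0) (Fintype.piFinset fun _ : Fin t => Finset.univ.image φ)).card := by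
    unfold cn
    apply Finset.card_bij (fun y _ => φ ∘ y)
    · intro y hy
      simp only [Finset.mem_filter, Finset.mem_univ, true_and, Fintype.mem_piFinset, Finset.mem_image] at *
      exact ⟨fun i => ⟨y i, rfl⟩, hy⟩
    · intro y _ z _ hyz
      funext i
      exact hφ (congrFun hyz i)
    · intro f hf
      simp only [Finset.mem_filter, Finset.mem_univ, true_and, Fintype.mem_piFinset, Finset.mem_image] at hf
      obtain ⟨hf1, hf2⟩ := hf
      choose y hy using hf1
      have : φ ∘ y = f := by funext i; exact hy i
      exact ⟨y, by simp [this, hf2], this⟩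
  rw [← h1] at h
  have hq : 0 < Fintype.card T := Fintype.card_pos
  have hq' : (0:ℚ≥0) < Fintype.card T := by exact_mod_cast hq
  rw [div_le_div_iff₀ (by positivity) hq'] at h
  exact_mod_cast h

theorem two_form {K T : Type} [Field K] {t : ℕ} [Fintype T] [Nonempty T] (φ : T → K) (hφ : Function.Injective φ)
    (D : ℕ) (hD : D + 1 ≤ Fintype.card T)
    (F F' : MvPolynomial (Fin t) K) (hF : F.totalDegree ≤ D) (hF' : F'.totalDegree ≤ D)
    (hind : ∀ c c' : K, C c * F + C c' * F' = 0 → c = 0 ∧ c' = 0) :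
    (cn (fun y : Fin t → T => eval (φ ∘ y) F = 0 ∧ eval (φ ∘ y) F' = 0) : ℝ) * (Fintype.card T : ℝ) ^ 2
      ≤ (((D : ℝ) - 1) * Fintype.card T + 1) * (Fintype.card T : ℝ) ^ t := by
  have hF0 : F ≠ 0 := by
    rintro rfl
    have := (hind 1 0 (by simp)).1
    exact one_ne_zero this
  have hF0' : F' ≠ 0 := by
    rintro rfl
    have := (hind 0 1 (by simp)).2
    exact one_ne_zero this
  obtain ⟨B, B', A, hrel, rfl, rfl⟩ := UniqueFactorizationMonoid.exists_reduced_factors F hF0 F'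
  have hA0 : A ≠ 0 := left_ne_zero_of_mul hF0
  have hB0 : B ≠ 0 := right_ne_zero_of_mul hF0
  have hB0' : B' ≠ 0 := right_ne_zero_of_mul hF0'
  rw [totalDegree_mul_of_isDomain hA0 hB0] at hF
  rw [totalDegree_mul_of_isDomain hA0 hB0'] at hF'
  obtain ⟨b, hb⟩ : ∃ b, D = A.totalDegree + b := ⟨D - A.totalDegree, by omega⟩
  have hb1 : 1 ≤ b := by
    by_contra hb1
    have h1 : B.totalDegree = 0 := by omega
    have h2 : B'.totalDegree = 0 := by omega
    rw [totalDegree_eq_zero_iff_eq_C] at h1 h2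
    have h3 := hind (coeff 0 B') (-coeff 0 B) (by
      rw [h1, h2]
      simp only [coeff_C, if_true, map_neg]
      ring)
    apply hB0'
    rw [h2, h3.1, C_0]
  have hc := coprime_count φ hφ B' b hb1 (by omega) B hB0 hrel
  have hs := sz φ hφ A hA0
  rw [Fintype.card_fin] at hc
  set q : ℝ := (Fintype.card T : ℝ) with hq
  have h3 : cn (fun y : Fin t → T => eval (φ ∘ y) (A * B) = 0 ∧ eval (φ ∘ y) (A * B') = 0) ≤
      cn (fun y : Fin t → T => eval (φ ∘ y) A = 0) + cn (fun y : Fin t → T => eval (φ ∘ y) B = 0 ∧ eval (φ ∘ y) B' = 0) := by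
      apply cn_or
      rintro y ⟨hy, hy'⟩
      rw [map_mul, mul_eq_zero] at hy hy'
      tauto
  have h3' : (cn (fun y : Fin t → T => eval (φ ∘ y) (A * B) = 0 ∧ eval (φ ∘ y) (A * B') = 0) : ℝ) ≤
      cn (fun y : Fin t → T => eval (φ ∘ y) A = 0) + cn (fun y : Fin t → T => eval (φ ∘ y) B = 0 ∧ eval (φ ∘ y) B' = 0) := by
      exact_mod_cast h3
  have hDq : (A.totalDegree : ℝ) + b + 1 ≤ q := by rw [hq]; exact_mod_cast (by omega : A.totalDegree + b + 1 ≤ Fintype.card T)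
  have hBd : (B.totalDegree : ℝ) ≤ b := by exact_mod_cast (by omega : B.totalDegree ≤ b)
  have hb1' : (1:ℝ) ≤ b := by exact_mod_cast hb1
  have hA1 : (0:ℝ) ≤ A.totalDegree := by positivity
  have hDD : (D:ℝ) = A.totalDegree + b := by exact_mod_cast hb
  have hq0 : 0 ≤ q := by positivity
  have hqt : 0 ≤ q ^ t := by positivity
  have h4 := mul_le_mul_of_nonneg_right h3' (by positivity : (0:ℝ) ≤ q ^ 2)
  have h5 := mul_le_mul_of_nonneg_right hs hq0
  have h6 : (B.totalDegree : ℝ) * b * q ^ t ≤ b * b * q ^ t := by gcongr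
  have h7 : (A.totalDegree : ℝ) * q + b * b ≤ (((D : ℝ) - 1) * q + 1) := by
    rw [hDD]; nlinarith
  have h8 := mul_le_mul_of_nonneg_right h7 hqt
  nlinarith



noncomputable def expo {t Δ : ℕ} (α : Fin t → Fin (Δ + 1)) : Fin t →₀ ℕ :=
  Finsupp.equivFunOnFinite.symm (fun i => (α i : ℕ))

theorem expo_inj {t Δ : ℕ} : Function.Injective (expo (t := t) (Δ := Δ)) := by
  intro a b h
  funext i
  have := DFunLike.congr_fun h i
  simp [expo] at this
  exact Fin.ext this

noncomputable def FV {t Δ : ℕ} (v : (Fin t → Fin (Δ + 1)) → ℂ) : MvPolynomial (Fin t) ℂ :=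
  ∑ α, monomial (expo α) (v α)

theorem eval_FV {t Δ : ℕ} (v : (Fin t → Fin (Δ + 1)) → ℂ) (y : Fin t → ℂ) : eval y (FV v) = evalVec v y := by
  unfold FV evalVec
  rw [map_sum]
  apply Finset.sum_congr rfl
  intro α _
  rw [eval_monomial, Finsupp.prod_fintype _ _ (by simp)]
  simp [expo]

theorem FV_eq_zero {t Δ : ℕ} (v : (Fin t → Fin (Δ + 1)) → ℂ) (h : FV v = 0) : v = 0 := by
  classical
  funext α
  have := congrArg (coeff (expo α)) h
  unfold FV at this
  rw [coeff_sum] at this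
  simp only [coeff_monomial, coeff_zero, expo_inj.eq_iff] at this
  simpa using this

theorem FV_lin {t Δ : ℕ} (v w : (Fin t → Fin (Δ + 1)) → ℂ) (c d : ℂ) :
    C c * FV v + C d * FV w = FV (c • v + d • w) := by
  unfold FV
  simp only [Finset.mul_sum, C_mul_monomial, ← Finset.sum_add_distrib, ← map_add]
  rfl

theorem evalVec_lin {t Δ : ℕ} (v w : (Fin t → Fin (Δ + 1)) → ℂ) (c d : ℂ) (y : Fin t → ℂ) :
    evalVec (c • v + d • w) y = c * evalVec v y + d * evalVec w y := by
  simp [← eval_FV, ← FV_lin]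

theorem FV_deg {t Δ : ℕ} (v : (Fin t → Fin (Δ + 1)) → ℂ)
    (h : ∀ α, Δ < ∑ i : Fin t, (α i : ℕ) → v α = 0) : (FV v).totalDegree ≤ Δ := by
  unfold FV
  apply totalDegree_finsetSum_le
  intro α _
  by_cases h0 : v α = 0
  · rw [h0]; simp
  · rw [totalDegree_monomial _ h0, Finsupp.sum_fintype _ _ (by simp)]
    by_contra h1
    apply h0
    apply h
    simpa [expo] using h1

noncomputable def lf {t Δ : ℕ} (J : Type) (y : Fin t → ℂ) : MvPolynomial ((Fin t → Fin (Δ + 1)) ⊕ J) ℂ :=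
  ∑ α : Fin t → Fin (Δ + 1), C (∏ i : Fin t, y i ^ (α i : ℕ)) * X (Sum.inl α)

theorem eval_lf {t Δ : ℕ} (J : Type) (y : Fin t → ℂ) (v : (Fin t → Fin (Δ + 1)) ⊕ J → ℂ) :
    eval v (lf J y) = evalVec (v ∘ Sum.inl) y := by
  simp [lf, evalVec, mul_comm]

theorem lf_deg {t Δ : ℕ} (J : Type) (y : Fin t → ℂ) : (lf (Δ := Δ) J y).totalDegree ≤ 1 := by
  unfold lf
  apply totalDegree_finsetSum_le
  intro α _
  refine (totalDegree_mul _ _).trans ?_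
  rw [totalDegree_C, totalDegree_X, zero_add]

theorem cn_pow {Γ : Type} [Fintype Γ] (p : Γ → Prop) (i : ℕ) :
    cn (fun γ : Fin i → Γ => ∀ j, p (γ j)) = cn p ^ i := by
  classical
  unfold cn
  have h : (Finset.univ.filter (fun γ : Fin i → Γ => ∀ j, p (γ j))) = Fintype.piFinset (fun _ : Fin i => Finset.univ.filter p) := by
    ext γ; simp [Fintype.mem_piFinset]
  have h2 := congrArg Finset.card h
  rw [Fintype.card_piFinset] at h2
  simp only [Finset.prod_const, Finset.card_univ, Fintype.card_fin] at h2
  convert h2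

/-- splitting off the first entry -/
theorem cn_head {Γ : Type} [Fintype Γ] (i : ℕ) (p : (Fin (i+1) → Γ) → Prop) (r : Γ → (Fin i → Γ) → Prop)
    (h : ∀ γ, p γ → r (γ 0) (Fin.tail γ)) : cn p ≤ ∑ y : Γ, cn (r y) := by
  classical
  refine (cn_le_sum Finset.univ p (fun y γ => p γ ∧ γ 0 = y) (fun γ hγ => ⟨γ 0, Finset.mem_univ _, hγ, rfl⟩)).trans ?_
  apply Finset.sum_le_sum
  intro y _
  unfold cn
  apply Finset.card_le_card_of_injOn (fun γ => Fin.tail γ)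
  · intro γ hγ
    simp only [Finset.coe_filter, Finset.mem_univ, true_and, Set.mem_ofPred_eq] at *
    rw [← hγ.2]; exact h γ hγ.1
  · intro γ hγ γ' hγ' he
    simp only [Finset.coe_filter, Finset.mem_univ, true_and, Set.mem_ofPred_eq] at *
    rw [← Fin.cons_self_tail γ, ← Fin.cons_self_tail γ', hγ.2, hγ'.2, he]

def BadP {t Δ : ℕ} {J T : Type} (φ : T → ℂ) (P : Ideal (MvPolynomial ((Fin t → Fin (Δ + 1)) ⊕ J) ℂ)) (i : ℕ)
    (γ : Fin i → Fin t → T) : Prop :=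
  ∃ v, IsZ P v ∧ v ∘ Sum.inl ≠ 0 ∧ ∀ j, evalVec (v ∘ Sum.inl) (φ ∘ γ j) = 0

theorem main_ind {t Δ : ℕ} {J T : Type} [Finite J] [Fintype T] [Nonempty T] (hΔ : 1 ≤ Δ) (φ : T → ℂ)
    (hφ : Function.Injective φ) (hq : Δ + 1 ≤ Fintype.card T) (i : ℕ) :
    ∀ P : Ideal (MvPolynomial ((Fin t → Fin (Δ + 1)) ⊕ J) ℂ), P.IsPrime →
    (∀ v, IsZ P v → ∀ α, Δ < ∑ i : Fin t, (α i : ℕ) → v (Sum.inl α) = 0) →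
    ∃ e : ℝ, 0 ≤ e ∧ Gr P (pdim P) e ∧
      (cn (BadP φ P i) : ℝ) ≤ ((Δ : ℝ) / Fintype.card T * (Fintype.card T : ℝ) ^ t) ^ i * e *
        ((Fintype.card T : ℝ) ^ 2 / ((Fintype.card T : ℝ) - 1)) ^ pdim P := by
  set q : ℝ := (Fintype.card T : ℝ) with hqdef
  have hΔ' : (1:ℝ) ≤ Δ := by exact_mod_cast hΔ
  have hqΔ : (Δ : ℝ) + 1 ≤ q := by rw [hqdef]; exact_mod_cast hq
  have hq1 : 0 < q - 1 := by linarith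
  have hq0 : 0 < q := by linarith
  set lam : ℝ := q ^ 2 / (q - 1) with hlam
  have hlam1 : 1 ≤ lam := by
    rw [hlam, le_div_iff₀ hq1]; nlinarith
  set U : ℝ := (Δ : ℝ) / q * q ^ t with hU
  have hU0 : 0 ≤ U := by positivity
  induction i with
  | zero =>
    intro P hP _
    refine ⟨1, zero_le_one, gr_one P, ?_⟩
    have h1 : cn (BadP φ P 0) ≤ 1 := cn_le_one _ (fun x y _ _ => Subsingleton.elim _ _)
    have h1' : (cn (BadP φ P 0) : ℝ) ≤ 1 := by exact_mod_cast h1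
    have h2 : 1 ≤ lam ^ pdim P := one_le_pow₀ hlam1
    simp only [pow_zero, one_mul]
    linarith
  | succ i ih =>
    intro P hP hsup
    have hpd : 1 ≤ lam ^ pdim P := one_le_pow₀ hlam1
    by_cases hA : ∃ v w, IsZ P v ∧ IsZ P w ∧ ∀ c d : ℂ, c • (v ∘ Sum.inl) + d • (w ∘ Sum.inl) = 0 → c = 0 ∧ d = 0
    · obtain ⟨v, w, hv, hw, hind⟩ := hA
      have h2f := two_form φ hφ Δ hq (FV (v ∘ Sum.inl)) (FV (w ∘ Sum.inl)) (FV_deg _ (hsup v hv)) (FV_deg _ (hsup w hw))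
        (by
          intro c d h
          rw [FV_lin] at h
          exact hind c d (FV_eq_zero _ h))
      obtain ⟨e0, he0, hg0, hb0⟩ := ih P hP hsup
      have h1 : ∀ Q : Ideal (MvPolynomial ((Fin t → Fin (Δ + 1)) ⊕ J) ℂ), ∃ e : ℝ,
          (∃ y : Fin t → T, lf J (φ ∘ y) ∉ P ∧ Q ∈ cutPrimes P (lf J (φ ∘ y))) → 0 ≤ e ∧ Gr Q (pdim Q) e ∧
          (cn (BadP φ Q i) : ℝ) * lam ≤ U ^ i * e * lam ^ pdim P := by
        intro Q
        by_cases hQ : (∃ y : Fin t → T, lf J (φ ∘ y) ∉ P ∧ Q ∈ cutPrimes P (lf J (φ ∘ y)))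
        · obtain ⟨y, hy, hQy⟩ := hQ
          have hd := pdim_drop P hy Q (mem_cutPrimes.1 hQy)
          have hPQ : P ≤ Q := le_sup_left.trans (mem_cutPrimes.1 hQy).1.2
          obtain ⟨e, he, hg, hb⟩ := ih Q (mem_cutPrimes.1 hQy).1.1 (fun v hv => hsup v (fun f hf => hv f (hPQ hf)))
          refine ⟨e, fun _ => ⟨he, hg, ?_⟩⟩
          rw [← hd, pow_succ, ← mul_assoc]
          exact mul_le_mul_of_nonneg_right hb (by linarith)
        · exact ⟨0, fun h => absurd h hQ⟩
      choose e he using h1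
      classical
      let E : Option (Fin t → T) → ℝ := fun o => match o with
        | none => e0
        | some y => if lf (Δ := Δ) J (φ ∘ y) ∈ P then 0 else ∑ Q ∈ cutPrimes P (lf J (φ ∘ y)), e Q
      have hE0 : ∀ o, 0 ≤ E o ∧ Gr P (pdim P) (E o) := by
        intro o
        match o with
        | none => exact ⟨he0, hg0⟩
        | some y =>
          simp only [E]
          split_ifs with hy
          · exact ⟨le_rfl, gr_zero _ _⟩
          · refine ⟨Finset.sum_nonneg (fun Q hQ => (he Q ⟨y, hy, hQ⟩).1), ?_⟩
            have := lemmaK P _ hy 1 le_rfl (lf_deg J _) e (fun Q hQ => (he Q ⟨y, hy, hQ⟩).1) (fun Q hQ => (he Q ⟨y, hy, hQ⟩).2.1)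
            simpa using this
      obtain ⟨o, ho⟩ := Finite.exists_max E
      refine ⟨E o, (hE0 o).1, (hE0 o).2, ?_⟩
      set N : ℕ := cn (fun y : Fin t → T => lf (Δ := Δ) J (φ ∘ y) ∈ P) with hN
      have hNle : (N : ℝ) * q ^ 2 ≤ (((Δ : ℝ) - 1) * q + 1) * q ^ t := by
        refine le_trans ?_ h2f
        apply mul_le_mul_of_nonneg_right _ (by positivity)
        rw [Nat.cast_le]
        apply cn_mono
        intro y hy
        rw [eval_FV, eval_FV, ← eval_lf, ← eval_lf]
        exact ⟨hv _ hy, hw _ hy⟩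
      have hcount : cn (BadP φ P (i+1)) ≤ ∑ y : Fin t → T,
          (if lf (Δ := Δ) J (φ ∘ y) ∈ P then cn (BadP φ P i) else ∑ Q ∈ cutPrimes P (lf J (φ ∘ y)), cn (BadP φ Q i)) := by
        refine (cn_head i _ (fun y γ => ∃ v, IsZ P v ∧ v ∘ Sum.inl ≠ 0 ∧ evalVec (v ∘ Sum.inl) (φ ∘ y) = 0 ∧
            ∀ j, evalVec (v ∘ Sum.inl) (φ ∘ γ j) = 0) ?_).trans ?_
        · rintro γ ⟨v, hv, hv0, hj⟩
          exact ⟨v, hv, hv0, hj 0, fun j => hj j.succ⟩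
        · apply Finset.sum_le_sum
          intro y _
          split_ifs with hy
          · apply cn_mono
            rintro γ ⟨v, hv, hv0, _, hj⟩
            exact ⟨v, hv, hv0, hj⟩
          · apply cn_le_sum
            rintro γ ⟨v, hv, hv0, h0, hj⟩
            obtain ⟨Q, hQ, hQv⟩ := isZ_split hv (f := lf J (φ ∘ y)) (by rw [eval_lf]; exact h0)
            exact ⟨Q, hQ, v, hQv, hv0, hj⟩
      set R : ℝ := U ^ i * E o * lam ^ pdim P with hR
      have hR0 : 0 ≤ R := by have := (hE0 o).1; positivity
      have hpt : ∀ y : Fin t → T, ((if lf (Δ := Δ) J (φ ∘ y) ∈ P then cn (BadP φ P i) else ∑ Q ∈ cutPrimes P (lf J (φ ∘ y)), cn (BadP φ Q i) : ℕ) : ℝ)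
          ≤ (if lf (Δ := Δ) J (φ ∘ y) ∈ P then R else 0) + R / lam := by
        intro y
        have hRl : 0 ≤ R / lam := by positivity
        split_ifs with hy
        · have h3 : E none ≤ E o := ho none
          have h4 : U ^ i * e0 * lam ^ pdim P ≤ R := by rw [hR]; gcongr
          linarith
        · rw [zero_add, le_div_iff₀ (by linarith)]
          push_cast
          rw [Finset.sum_mul]
          calc _ ≤ ∑ Q ∈ cutPrimes P (lf J (φ ∘ y)), U ^ i * e Q * lam ^ pdim P :=
                Finset.sum_le_sum (fun Q hQ => (he Q ⟨y, hy, hQ⟩).2.2)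
            _ = U ^ i * (E (some y)) * lam ^ pdim P := by
                simp only [E, if_neg hy]
                rw [Finset.mul_sum, Finset.sum_mul]
            _ ≤ R := by rw [hR]; gcongr; exact ho (some y)
      have hNN : ∑ y : Fin t → T, (if lf (Δ := Δ) J (φ ∘ y) ∈ P then R else 0) = N * R := by
        rw [← Finset.sum_filter, Finset.sum_const, nsmul_eq_mul, hN]
        unfold cn
        congr!
      have hcount' : (cn (BadP φ P (i+1)) : ℝ) ≤ N * R + q ^ t * (R / lam) := by
        calc (cn (BadP φ P (i+1)) : ℝ) ≤ _ := Nat.cast_le.2 hcount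
          _ ≤ ∑ y : Fin t → T, ((if lf (Δ := Δ) J (φ ∘ y) ∈ P then R else 0) + R / lam) := by
              rw [Nat.cast_sum]
              exact Finset.sum_le_sum (fun y _ => hpt y)
          _ = _ := by
              rw [Finset.sum_add_distrib, hNN]
              simp [hqdef]
      have hfin : (N : ℝ) + q ^ t / lam ≤ U := by
        have h5 : (N : ℝ) ≤ (((Δ : ℝ) - 1) * q + 1) * q ^ t / q ^ 2 := by
          rw [le_div_iff₀ (by positivity)]; exact hNle
        have h6 : (((Δ : ℝ) - 1) * q + 1) * q ^ t / q ^ 2 + q ^ t / lam = U := by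
          rw [hU, hlam]
          field_simp
          ring
        linarith
      calc (cn (BadP φ P (i+1)) : ℝ) ≤ N * R + q ^ t * (R / lam) := hcount'
        _ = (N + q ^ t / lam) * R := by ring
        _ ≤ U * R := mul_le_mul_of_nonneg_right hfin hR0
        _ = _ := by rw [hR]; ring
    · push Not at hA
      refine ⟨1, zero_le_one, gr_one P, ?_⟩
      suffices h : (cn (BadP φ P (i+1)) : ℝ) ≤ U ^ (i+1) by
        have : 0 ≤ U ^ (i+1) := by positivity
        nlinarith
      by_cases hz : ∃ v, IsZ P v ∧ v ∘ Sum.inl ≠ 0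
      · obtain ⟨v, hv, hv0⟩ := hz
        have h1 : cn (BadP φ P (i+1)) ≤ cn (fun y : Fin t → T => eval (φ ∘ y) (FV (v ∘ Sum.inl)) = 0) ^ (i+1) := by
          rw [← cn_pow]
          apply cn_mono
          rintro γ ⟨w, hw, hw0, hj⟩ j
          obtain ⟨c, d, hcd, hne⟩ := hA v w hv hw
          have hc : c ≠ 0 := by
            intro hc
            have hd := hne hc
            rw [hc, zero_smul, zero_add, smul_eq_zero] at hcd
            tauto
          have h2 := evalVec_lin (v ∘ Sum.inl) (w ∘ Sum.inl) c d (φ ∘ γ j)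
          rw [hcd, hj j, mul_zero, add_zero] at h2
          have h3 : evalVec (0 : (Fin t → Fin (Δ + 1)) → ℂ) (φ ∘ γ j) = 0 := by simp [evalVec]
          rw [h3] at h2
          rw [eval_FV]
          exact (mul_eq_zero.1 h2.symm).resolve_left hc
        have h2 := sz φ hφ (FV (v ∘ Sum.inl)) (fun h => hv0 (FV_eq_zero _ h))
        have h3 : ((FV (v ∘ Sum.inl)).totalDegree : ℝ) ≤ Δ := by exact_mod_cast FV_deg _ (hsup v hv)
        have h4 : (cn (fun y : Fin t → T => eval (φ ∘ y) (FV (v ∘ Sum.inl)) = 0) : ℝ) ≤ U := by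
          rw [hU, div_mul_eq_mul_div, le_div_iff₀ hq0]
          exact h2.trans (by gcongr)
        calc (cn (BadP φ P (i+1)) : ℝ) ≤ (cn (fun y : Fin t → T => eval (φ ∘ y) (FV (v ∘ Sum.inl)) = 0) : ℝ) ^ (i+1) := by exact_mod_cast h1
          _ ≤ _ := by gcongr
      · rw [cn_false]
        · simp only [Nat.cast_zero]; positivity
        · rintro γ ⟨v, hv, hv0, _⟩
          exact hz ⟨v, hv, hv0⟩


theorem deg_aeval {σ τ : Type} (h : σ → MvPolynomial τ ℂ) (D : ℕ) (hh : ∀ i, (h i).totalDegree ≤ D)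
    (f : MvPolynomial σ ℂ) : (aeval h f).totalDegree ≤ f.totalDegree * D := by
  classical
  rw [aeval_def, eval₂_eq]
  apply totalDegree_finsetSum_le
  intro d hd
  refine (totalDegree_mul _ _).trans ?_
  have h1 : (algebraMap ℂ (MvPolynomial τ ℂ) (coeff d f)).totalDegree = 0 := by
    rw [algebraMap_eq, totalDegree_C]
  rw [h1, zero_add]
  refine (totalDegree_finsetProd _ _).trans ?_
  have h2 : ∑ i ∈ d.support, d i ≤ f.totalDegree := le_totalDegree hd
  calc _ ≤ ∑ i ∈ d.support, d i * D := by
        apply Finset.sum_le_sum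
        intro i _
        refine (totalDegree_pow _ _).trans ?_
        exact Nat.mul_le_mul_left _ (hh i)
    _ = (∑ i ∈ d.support, d i) * D := by rw [Finset.sum_mul]
    _ ≤ _ := Nat.mul_le_mul_right _ h2

theorem range_kerLift {R A B : Type} [CommRing R] [CommRing A] [CommRing B] [Algebra R A] [Algebra R B] (f : A →ₐ[R] B) :
    (Ideal.kerLiftAlg f).range = f.range := by
  ext x
  constructor
  · rintro ⟨a, rfl⟩
    obtain ⟨b, rfl⟩ := Ideal.Quotient.mk_surjective a
    exact ⟨b, rfl⟩
  · rintro ⟨b, rfl⟩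
    exact ⟨Ideal.Quotient.mk _ b, rfl⟩

theorem setup {ι : Type} [Finite ι] {L D : ℕ} (hD : 1 ≤ D) (g : ι → MvPolynomial (Fin L) ℂ) (hg : ∀ i, (g i).totalDegree ≤ D) :
    ∃ (J : Type) (_ : Finite J) (P : Ideal (MvPolynomial (ι ⊕ J) ℂ)), P.IsPrime ∧ pdim P = L ∧
      (∀ e, Gr P L e → e ≤ (D : ℝ) ^ L) ∧
      (∀ v : ι → ℂ, (∀ f, aeval g f = 0 → eval v f = 0) → ∃ w, IsZ P (Sum.elim v w)) ∧
      (∀ i, g i = 0 → X (Sum.inl i) ∈ P) := by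
  let R1 := Algebra.adjoin ℂ (Set.range g)
  have halg : Algebra.IsAlgebraic (Algebra.adjoin R1 (Set.range (X : Fin L → (MvPolynomial (Fin L) ℂ)))) (MvPolynomial (Fin L) ℂ) := by
    have h1 : (Algebra.adjoin R1 (Set.range (X : Fin L → (MvPolynomial (Fin L) ℂ)))).restrictScalars ℂ = ⊤ := by
      rw [← Algebra.adjoin_union_eq_adjoin_adjoin, eq_top_iff, ← adjoin_range_X]
      exact Algebra.adjoin_mono Set.subset_union_right
    refine ⟨fun a => ?_⟩
    have ha : a ∈ (Algebra.adjoin R1 (Set.range (X : Fin L → (MvPolynomial (Fin L) ℂ)))).restrictScalars ℂ := by rw [h1]; trivial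
    exact isAlgebraic_algebraMap (⟨a, ha⟩ : Algebra.adjoin R1 (Set.range (X : Fin L → (MvPolynomial (Fin L) ℂ))))
  obtain ⟨s, hs, hb⟩ := exists_isTranscendenceBasis_subset (R := R1) (Set.range (X : Fin L → (MvPolynomial (Fin L) ℂ)))
  have hsf : s.Finite := (Set.finite_range _).subset hs
  let h : ι ⊕ s → (MvPolynomial (Fin L) ℂ) := Sum.elim g (fun j => j.1)
  let f : MvPolynomial (ι ⊕ s) ℂ →ₐ[ℂ] (MvPolynomial (Fin L) ℂ) := aeval h
  have hdeg : ∀ i, (h i).totalDegree ≤ D := by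
    rintro (i | j)
    · exact hg i
    · obtain ⟨k, hk⟩ := hs j.2
      simp only [h, Sum.elim_inr, ← hk]
      rw [totalDegree_X]; exact hD
  refine ⟨s, hsf.to_subtype, RingHom.ker f, RingHom.ker_isPrime _, ?_, ?_, ?_, ?_⟩
  · -- dimension
    have e1 : (MvPolynomial (ι ⊕ s) ℂ ⧸ RingHom.ker f) ≃ₐ[ℂ] (Ideal.kerLiftAlg f).range :=
      AlgEquiv.ofInjective _ (Ideal.kerLiftAlg_injective f)
    have hr : (Ideal.kerLiftAlg f).range = (Algebra.adjoin R1 s).restrictScalars ℂ := by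
      rw [range_kerLift, ← Algebra.adjoin_union_eq_adjoin_adjoin, ← Algebra.adjoin_range_eq_range_aeval]
      congr 1
      simp [h, Set.Sum.elim_range]
    rw [hr] at e1
    have h2 : Algebra.IsAlgebraic ((Algebra.adjoin R1 s).restrictScalars ℂ) (MvPolynomial (Fin L) ℂ) := by
      have := hb.isAlgebraic
      rw [Subtype.range_coe] at this
      exact this
    have h3 : tdeg ℂ (MvPolynomial (Fin L) ℂ) = tdeg ℂ ((Algebra.adjoin R1 s).restrictScalars ℂ) := tdeg_of_integral
    unfold pdim
    have h4 : tdeg ℂ (MvPolynomial (ι ⊕ s) ℂ ⧸ RingHom.ker f) = tdeg ℂ ((Algebra.adjoin R1 s).restrictScalars ℂ) := by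
      unfold tdeg; rw [AlgEquiv.trdeg_eq e1]
    rw [h4, ← h3]
    unfold tdeg
    simp
  · rintro e ⟨c, hc⟩
    apply asym L D hD e c
    intro n
    refine (hc n).trans ?_
    rw [Nat.cast_le]
    unfold hfn
    have h5 : Module.finrank ℂ (restrictTotalDegree (Fin L) ℂ ((n+c)*D)) = ((n+c)*D+L).choose L := by
      rw [finrank_rtd, Fintype.card_fin]
    rw [← h5]
    have hinj : Function.Injective (Ideal.kerLiftAlg f).toLinearMap := Ideal.kerLiftAlg_injective f
    rw [(Submodule.equivMapOfInjective _ hinj _).finrank_eq]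
    have : Module.Finite ℂ (restrictTotalDegree (Fin L) ℂ ((n+c)*D)) := 
      Module.finite_of_finrank_pos (by rw [h5]; exact Nat.choose_pos (by omega))
    apply Submodule.finrank_mono
    rintro _ ⟨_, ⟨p, hp, rfl⟩, rfl⟩
    rw [mem_restrictTotalDegree]
    have hp' : p.totalDegree ≤ n + c := (mem_restrictTotalDegree _ _ _).1 hp
    refine (deg_aeval h D hdeg p).trans ?_
    exact Nat.mul_le_mul_right _ hp'
  · intro v hv
    refine ⟨0, ?_⟩
    intro p hp
    have hp : aeval h p = 0 := hp
    let g1 : ι → R1 := fun i => ⟨g i, Algebra.subset_adjoin ⟨i, rfl⟩⟩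
    let ψ : MvPolynomial (ι ⊕ s) ℂ →ₐ[ℂ] MvPolynomial s R1 := aeval (Sum.elim (fun i => C (g1 i)) X)
    have h1 : ∀ p, aeval (R := R1) (fun j : s => j.1) (ψ p) = aeval h p := by
      intro p
      have : ((aeval (R := R1) (fun j : s => j.1)).restrictScalars ℂ).comp ψ = aeval h := by
        apply MvPolynomial.algHom_ext
        rintro (i | j)
        · simp [ψ, h, g1]
        · simp [ψ, h]
      exact DFunLike.congr_fun this p
    have h2 : ψ p = 0 := by
      have := hb.1
      rw [algebraicIndependent_iff] at this
      exact this _ ((h1 p).trans hp)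
    let p0 : MvPolynomial ι ℂ := aeval (Sum.elim X (0 : s → MvPolynomial ι ℂ)) p
    have h3 : aeval g p0 = ((aeval (R := R1) (0 : s → R1) (ψ p) : R1) : (MvPolynomial (Fin L) ℂ)) := by
      have : (aeval g : MvPolynomial ι ℂ →ₐ[ℂ] (MvPolynomial (Fin L) ℂ)).comp (aeval (Sum.elim X (0 : s → MvPolynomial ι ℂ))) =
        R1.val.comp (((aeval (R := R1) (0 : s → R1)).restrictScalars ℂ).comp ψ) := by
        apply MvPolynomial.algHom_ext
        rintro (i | j)
        · simp [ψ, g1]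
        · simp [ψ]
      exact DFunLike.congr_fun this p
    have h4 : eval v p0 = eval (Sum.elim v 0) p := by
      have : (aeval v : MvPolynomial ι ℂ →ₐ[ℂ] ℂ).comp (aeval (Sum.elim X (0 : s → MvPolynomial ι ℂ))) =
        aeval (Sum.elim v (0 : s → ℂ)) := by
        apply MvPolynomial.algHom_ext
        rintro (i | j) <;> simp
      have := DFunLike.congr_fun this p
      simpa [aeval_eq_eval, p0] using this
    rw [← h4]
    apply hv
    rw [h3, h2]
    simp
  · intro i hi
    rw [RingHom.mem_ker]
    simp [f, h, hi]


theorem cn_true {Γ : Type} [Fintype Γ] (p : Γ → Prop) (h : ∀ x, p x) : cn p = Fintype.card Γ := by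
  classical
  unfold cn
  rw [← Finset.card_univ]
  congr 1
  ext x
  simp [h x]

theorem arith_bound (t L m : ℕ) (a d q e : ℝ) (ht : 1 ≤ t) (hm : 2 * L + 2 ≤ m) (ha : 1 ≤ a) (hd : 1 ≤ d)
    (hq : a ^ 2 * d ≤ q - 1) (he : e ≤ d ^ L) :
    (a / q * q ^ t) ^ m * e * (q ^ 2 / (q - 1)) ^ L ≤ q ^ (m * t - 1) := by
  have had : a ^ 2 ≤ a ^ 2 * d := le_mul_of_one_le_right (by positivity) hd
  have ha2 : a ≤ a ^ 2 := by nlinarith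
  have hq1 : 0 < q - 1 := by nlinarith
  have hq0 : 0 < q := by linarith
  have h1 : (a / q) ^ m ≤ (a / q) ^ (2 * L + 2) := by
    apply pow_le_pow_of_le_one (by positivity) _ hm
    rw [div_le_one hq0]; linarith
  have h2 : (a / q) ^ (2 * L + 2) * d ^ L * (q ^ 2 / (q - 1)) ^ L = (a ^ 2 * d / (q - 1)) ^ L * (a ^ 2 / q ^ 2) := by
    have h0 : a ^ 2 * d / (q - 1) = (a / q) ^ 2 * d * (q ^ 2 / (q - 1)) := by field_simp
    rw [pow_add, pow_mul, h0, mul_pow, mul_pow, ← div_pow]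
    ring
  have h3 : (a ^ 2 * d / (q - 1)) ^ L ≤ 1 := by
    apply pow_le_one₀ (by positivity)
    rw [div_le_one hq1]; exact hq
  have h4 : a ^ 2 / q ^ 2 ≤ 1 / q := by
    rw [div_le_div_iff₀ (by positivity) hq0]
    nlinarith
  obtain ⟨k, hk⟩ : ∃ k, m * t = k + 1 := ⟨m * t - 1, by
    have : 1 ≤ m * t := Nat.mul_pos (by omega) ht
    omega⟩
  have h5 : (a / q * q ^ t) ^ m = (a / q) ^ m * q ^ (m * t) := by
    rw [mul_pow, ← pow_mul, mul_comm t m]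
  rw [h5, hk, Nat.add_sub_cancel]
  have hl : 0 ≤ (q ^ 2 / (q - 1)) ^ L := by positivity
  calc (a / q) ^ m * q ^ (k + 1) * e * (q ^ 2 / (q - 1)) ^ L
      ≤ (a / q) ^ m * q ^ (k + 1) * d ^ L * (q ^ 2 / (q - 1)) ^ L := by gcongr
    _ ≤ (a / q) ^ (2 * L + 2) * q ^ (k + 1) * d ^ L * (q ^ 2 / (q - 1)) ^ L := by gcongr
    _ = ((a / q) ^ (2 * L + 2) * d ^ L * (q ^ 2 / (q - 1)) ^ L) * q ^ (k + 1) := by ring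
    _ = ((a ^ 2 * d / (q - 1)) ^ L * (a ^ 2 / q ^ 2)) * q ^ (k + 1) := by rw [h2]
    _ ≤ (1 * (1 / q)) * q ^ (k + 1) := by gcongr
    _ = q ^ k := by rw [pow_succ]; field_simp

theorem zcl_mem {t L Δ : ℕ} {D : Set (Fin L → ℂ)} {Ω : (Fin t → Fin (Δ + 1)) → MvPolynomial (Fin L) ℚ}
    {v : (Fin t → Fin (Δ + 1)) → ℂ} (hv : v ∈ zClosure (objClass t L Δ D Ω))
    (f : MvPolynomial (Fin t → Fin (Δ + 1)) ℂ)
    (hf : aeval (fun α => map (algebraMap ℚ ℂ) (Ω α)) f = 0) : eval v f = 0 := by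
  have h1 := hv {x | ∀ f ∈ {f : MvPolynomial (Fin t → Fin (Δ + 1)) ℂ | aeval (fun α => map (algebraMap ℚ ℂ) (Ω α)) f = 0}, eval x f = 0}
    ⟨⟨_, rfl⟩, by
      rintro _ ⟨c, _, rfl⟩ f hf
      have hf : aeval (fun α => map (algebraMap ℚ ℂ) (Ω α)) f = 0 := hf
      have h2 : (aeval c : MvPolynomial (Fin L) ℂ →ₐ[ℂ] ℂ).comp (aeval (fun α => map (algebraMap ℚ ℂ) (Ω α))) =
        aeval (fun α => aeval c (Ω α)) := by
        apply MvPolynomial.algHom_ext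
        intro α
        simp [eval_map, aeval_def]
      have h3 := DFunLike.congr_fun h2 f
      rw [AlgHom.comp_apply, hf, map_zero] at h3
      rw [aeval_eq_eval] at h3
      exact h3.symm⟩
  exact h1 f hf

theorem bad_count
    (t L K Δ Δ1 Δ2 m : ℕ)
    (ht : 1 ≤ t) (hL : 1 ≤ L) (hΔ : 1 ≤ Δ) (hΔ2 : 1 ≤ Δ2)
    (hm : 2 * L + 2 ≤ m)
    (D : Set (Fin L → ℂ))
    (Ω : (Fin t → Fin (Δ + 1)) → MvPolynomial (Fin L) ℚ)
    (hΩdeg : ∀ α, (Ω α).totalDegree ≤ Δ2)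
    (hΩsupp : ∀ α : Fin t → Fin (Δ + 1), Δ < ∑ i : Fin t, (α i : ℕ) → Ω α = 0)
    (M : Finset ℚ) (hM2 : 2 ≤ M.card)
    (hMbig : (Δ : ℝ) ^ 2 * ((L : ℝ) + 1) ^ ((1 : ℝ) / (L : ℝ)) *
        (1 + (K : ℝ) * (Δ1 : ℝ)) * (Δ2 : ℝ) ≤ (M.card : ℝ)) :
    cn (fun γ : Fin m → Fin t → {x : ℚ // x ∈ M} => 
          ¬ ∀ v ∈ zClosure (objClass t L Δ D Ω),
              (∀ i : Fin m, evalVec v (fun j => ((γ i j : ℚ) : ℂ)) = 0) → v = 0)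
        ≤ M.card ^ (m * t - 1) := by
  have hL' : (1:ℝ) ≤ L := by exact_mod_cast hL
  have hΔ' : (1:ℝ) ≤ Δ := by exact_mod_cast hΔ
  have hΔ2' : (1:ℝ) ≤ Δ2 := by exact_mod_cast hΔ2
  have hs : 1 < ((L : ℝ) + 1) ^ ((1 : ℝ) / (L : ℝ)) := Real.one_lt_rpow (by linarith) (by positivity)
  have hlt : (Δ : ℝ) ^ 2 * Δ2 < M.card := by
    refine lt_of_lt_of_le ?_ hMbig
    have h1 : (1:ℝ) ≤ 1 + (K : ℝ) * (Δ1 : ℝ) := le_add_of_nonneg_right (by positivity)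
    have h2 : 1 < ((L : ℝ) + 1) ^ ((1 : ℝ) / (L : ℝ)) * (1 + (K : ℝ) * (Δ1 : ℝ)) := lt_of_lt_of_le hs (le_mul_of_one_le_right (by linarith) h1)
    have h3 : 0 < (Δ : ℝ) ^ 2 * Δ2 := by positivity
    nlinarith
  have hltN : Δ ^ 2 * Δ2 + 1 ≤ M.card := by
    have : Δ ^ 2 * Δ2 < M.card := by exact_mod_cast hlt
    omega
  have hcard : Fintype.card {x : ℚ // x ∈ M} = M.card := Fintype.card_coe M
  have hΔq : Δ + 1 ≤ Fintype.card {x : ℚ // x ∈ M} := by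
    rw [hcard]
    have : Δ ≤ Δ ^ 2 * Δ2 := by nlinarith
    omega
  have hne : Nonempty {x : ℚ // x ∈ M} := by
    rw [← Fintype.card_pos_iff]; omega
  let φ : {x : ℚ // x ∈ M} → ℂ := fun x => ((x : ℚ) : ℂ)
  have hφ : Function.Injective φ := by
    intro x y hxy
    exact Subtype.ext (Rat.cast_injective hxy)
  obtain ⟨J, hJ, P, hP, hpd, hGr, hext, hX⟩ := setup (L := L) hΔ2 (fun α => map (algebraMap ℚ ℂ) (Ω α))
    (fun α => (Finset.sup_mono (support_map_subset _ _)).trans (hΩdeg α))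
  obtain ⟨e, he0, hge, hbd⟩ := main_ind hΔ φ hφ hΔq m P hP (by
    intro v hv α hα
    have := hv _ (hX α (by rw [hΩsupp α hα, map_zero]))
    simpa using this)
  rw [hpd] at hge hbd
  have heD := hGr e hge
  have h1 : cn (fun γ : Fin m → Fin t → {x : ℚ // x ∈ M} => 
          ¬ ∀ v ∈ zClosure (objClass t L Δ D Ω),
              (∀ i : Fin m, evalVec v (fun j => ((γ i j : ℚ) : ℂ)) = 0) → v = 0) ≤ cn (BadP φ P m) := by
    apply cn_mono
    intro γ hγ
    push Not at hγ
    obtain ⟨v, hv, hev, hv0⟩ := hγ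
    obtain ⟨w, hw⟩ := hext v (fun f hf => zcl_mem hv f hf)
    exact ⟨Sum.elim v w, hw, by simpa using hv0, fun j => hev j⟩
  have hltR : (Δ : ℝ) ^ 2 * Δ2 ≤ (M.card : ℝ) - 1 := by
    have : ((Δ ^ 2 * Δ2 + 1 : ℕ) : ℝ) ≤ M.card := Nat.cast_le.2 hltN
    push_cast at this
    linarith
  have h2 := arith_bound t L m Δ Δ2 M.card e ht hm hΔ' hΔ2' hltR heD
  rw [hcard] at hbd
  have h3 : (cn (BadP φ P m) : ℝ) ≤ ((M.card ^ (m * t - 1) : ℕ) : ℝ) := by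
    push_cast
    exact hbd.trans h2
  exact h1.trans (by exact_mod_cast h3)

end

/-- Existence (and abundance) of correct test sequences of length `m ≥ 2L+2`
with entries in a sufficiently large finite set `M ⊆ ℚ` for the Zariski closure
`Ō` of a holomorphically encoded `ℚ`-constructible object class `O` of
`t`-variate polynomials of degree at most `Δ`. -/
theorem correct_test_sequence_exists
    (t L K Δ Δ1 Δ2 m : ℕ)
    (ht : 1 ≤ t) (hL : 1 ≤ L) (hK : 1 ≤ K) (hΔ : 1 ≤ Δ) (hΔ2 : 1 ≤ Δ2)
    (hm : 2 * L + 2 ≤ m)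
    (G : Fin K → MvPolynomial (Fin L) ℚ) (hG : ∀ i, (G i).totalDegree ≤ Δ1)
    (D : Set (Fin L → ℂ))
    (hD : InBoolAlg
      (Set.range fun i : Fin K => {c : Fin L → ℂ | MvPolynomial.aeval c (G i) = 0}) D)
    (Ω : (Fin t → Fin (Δ + 1)) → MvPolynomial (Fin L) ℚ)
    (hΩdeg : ∀ α, (Ω α).totalDegree ≤ Δ2)
    (hΩsupp : ∀ α : Fin t → Fin (Δ + 1), Δ < ∑ i : Fin t, (α i : ℕ) → Ω α = 0)
    (M : Finset ℚ) (hM2 : 2 ≤ M.card)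
    (hMbig : (Δ : ℝ) ^ 2 * ((L : ℝ) + 1) ^ ((1 : ℝ) / (L : ℝ)) *
        (1 + (K : ℝ) * (Δ1 : ℝ)) * (Δ2 : ℝ) ≤ (M.card : ℝ)) :
    (∃ γ : Fin m → Fin t → ℚ, (∀ i j, γ i j ∈ M) ∧
        ∀ v ∈ zClosure (objClass t L Δ D Ω),
          (∀ i : Fin m, evalVec v (fun j => ((γ i j : ℚ) : ℂ)) = 0) → v = 0) ∧
      {γ : Fin m → Fin t → {x : ℚ // x ∈ M} |
          ¬ ∀ v ∈ zClosure (objClass t L Δ D Ω),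
              (∀ i : Fin m, evalVec v (fun j => ((γ i j : ℚ) : ℂ)) = 0) → v = 0}.ncard
        ≤ M.card ^ (m * t - 1) := by
  classical
  have hb := bad_count t L K Δ Δ1 Δ2 m ht hL hΔ hΔ2 hm D Ω hΩdeg hΩsupp M hM2 hMbig
  constructor
  · by_contra hcon
    have hall : ∀ γ : Fin m → Fin t → {x : ℚ // x ∈ M}, ¬ ∀ v ∈ zClosure (objClass t L Δ D Ω),
              (∀ i : Fin m, evalVec v (fun j => ((γ i j : ℚ) : ℂ)) = 0) → v = 0 := by
      intro γ hγ
      exact hcon ⟨fun i j => (γ i j : ℚ), fun i j => (γ i j).2, hγ⟩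
    have h1 : cn (fun γ : Fin m → Fin t → {x : ℚ // x ∈ M} =>
          ¬ ∀ v ∈ zClosure (objClass t L Δ D Ω),
              (∀ i : Fin m, evalVec v (fun j => ((γ i j : ℚ) : ℂ)) = 0) → v = 0) = M.card ^ (m * t) := by
      rw [cn_true _ hall]
      simp [← pow_mul, mul_comm]
    rw [h1] at hb
    have h2 : 1 ≤ m * t := Nat.mul_pos (by omega) ht
    have h3 : M.card ^ (m * t - 1) < M.card ^ (m * t) := Nat.pow_lt_pow_right (by omega) (by omega)
    omega
  · refine le_trans (le_of_eq ?_) hb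
    unfold cn
    rw [← Set.ncard_coe_finset]
    congr 1
    ext γ
    simp
end
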